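/- arXiv:0906.5023 — 3 statements merged into one kernel-verified Lean document; each statement's English description precedes it below -/
import Mathlib

section
/- For every m ∈ {4, 5, 6, 7, 8}, there exists an extremal Type II ℤ_{12}-code of length 8m, i.e., a Type II ℤ_{12}-code C of length 8m with d_E(C) = 24·⌊8m/24⌋ + 24. -/
open scoped BigOperators

/-- Euclidean weight of a word over `ℤ/mℤ`. -/
def euclWt {m : ℕ} {ι : Type*} [Fintype ι] (x : ι → ZMod m) : ℕ :=
  ∑ i, min ((x i).val ^ 2) ((m - (x i).val) ^ 2)

/-- The dual code under the standard inner product. -/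
def dualCode {m : ℕ} {ι : Type*} [Fintype ι]
    (C : Submodule (ZMod m) (ι → ZMod m)) : Set (ι → ZMod m) :=
  {x | ∀ y ∈ C, ∑ i, x i * y i = 0}

/-- A code is self-dual if it coincides with its dual code. -/
def IsSelfDualCode {m : ℕ} {ι : Type*} [Fintype ι]
    (C : Submodule (ZMod m) (ι → ZMod m)) : Prop :=
  (C : Set (ι → ZMod m)) = dualCode C

/-- A Type II `ℤ_{2k}`-code: self-dual with all Euclidean weights divisible by `4k`. -/
def IsTypeII (k : ℕ) {ι : Type*} [Fintype ι]
    (C : Submodule (ZMod (2 * k)) (ι → ZMod (2 * k))) : Prop :=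
  IsSelfDualCode C ∧ ∀ c ∈ C, 4 * k ∣ euclWt c

/-- The minimum Euclidean weight of a code. -/
noncomputable def minEuclWt {m : ℕ} {ι : Type*} [Fintype ι]
    (C : Submodule (ZMod m) (ι → ZMod m)) : ℕ :=
  sInf {w | ∃ c ∈ C, c ≠ 0 ∧ euclWt c = w}

/-- Standard inner product on `ι → ℝ`. -/
def ip {ι : Type*} [Fintype ι] (x y : ι → ℝ) : ℝ := ∑ i, x i * y i

/-- A lattice: a discrete `ℤ`-submodule of `ℝ^ι` spanning it over `ℝ`. -/
def IsLatticeIn {ι : Type*} [Fintype ι] (L : Submodule ℤ (ι → ℝ)) : Prop :=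
  DiscreteTopology L ∧ Submodule.span ℝ (L : Set (ι → ℝ)) = ⊤

/-- The dual lattice. -/
def dualLattice {ι : Type*} [Fintype ι] (L : Submodule ℤ (ι → ℝ)) : Set (ι → ℝ) :=
  {x | ∀ y ∈ L, ∃ z : ℤ, ip x y = (z : ℝ)}

/-- A lattice is unimodular if it equals its dual. -/
def IsUnimodularLattice {ι : Type*} [Fintype ι] (L : Submodule ℤ (ι → ℝ)) : Prop :=
  (L : Set (ι → ℝ)) = dualLattice L

/-- A lattice is even if every vector has even integral norm. -/
def IsEvenLattice {ι : Type*} [Fintype ι] (L : Submodule ℤ (ι → ℝ)) : Prop :=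
  ∀ x ∈ L, ∃ z : ℤ, ip x x = 2 * (z : ℝ)

/-- `r` is the minimum norm of the lattice `L`. -/
def HasMinNorm {ι : Type*} [Fintype ι] (L : Submodule ℤ (ι → ℝ)) (r : ℝ) : Prop :=
  IsLeast {t : ℝ | ∃ x ∈ L, x ≠ 0 ∧ ip x x = t} r

/-- Construction A: the set `(1/√m)·{x ∈ ℤ^ι : (x mod m) ∈ C}`. -/
def constructionA (m : ℕ) {ι : Type*} [Fintype ι] (C : Set (ι → ZMod m)) :
    Set (ι → ℝ) :=
  {v | ∃ x : ι → ℤ, (fun i => (x i : ZMod m)) ∈ C ∧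
    v = fun i => (x i : ℝ) / Real.sqrt m}

/-- A negacirculant matrix. -/
def IsNegacirculant {m : ℕ} {R : Type*} [CommRing R] (A : Matrix (Fin m) (Fin m) R) : Prop :=
  ∃ r : Fin m → R, ∀ i j : Fin m,
    A i j = if h : (i : ℕ) ≤ (j : ℕ) then r ⟨(j : ℕ) - (i : ℕ), by have := j.isLt; omega⟩
      else - r ⟨m + (j : ℕ) - (i : ℕ), by have := i.isLt; have := j.isLt; omega⟩

namespace ExtremalZ12

variable {ι : Type*}

/-- Reduction modulo `m` of an integer vector. -/
def reduce (m : ℕ) : (ι → ℤ) →ₗ[ℤ] (ι → ZMod m) where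
  toFun x i := (x i : ZMod m)
  map_add' x y := by ext; simp
  map_smul' a x := by ext; simp

@[simp] lemma reduce_apply (m : ℕ) (x : ι → ℤ) (i : ι) : reduce m x i = (x i : ZMod m) := rfl

lemma dvd_sub_of_reduce_eq {m : ℕ} {x y : ι → ℤ} (h : reduce m x = reduce m y) (i : ι) :
    (m : ℤ) ∣ y i - x i :=
  (ZMod.intCast_eq_intCast_iff_dvd_sub _ _ _).1 (congrFun h i)

/-- The minimal integer representatives of a word over `ℤ₁₂`. -/
def minLift (c : ι → ZMod (2 * 6)) (i : ι) : ℤ := (c i).valMinAbs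

@[simp] lemma reduce_minLift (c : ι → ZMod (2 * 6)) : reduce (2 * 6) (minLift c) = c := by
  ext i
  simp [minLift]

/-- Parity decomposition of an integer vector whose entries have equal parity. -/
lemma exists_parity {x : ι → ℤ} (h : ∀ i j, 2 ∣ x i - x j) :
    ∃ (p : ℤ) (u : ι → ℤ), (p = 0 ∨ p = 1) ∧ ∀ i, x i = p + 2 * u i := by
  rcases isEmpty_or_nonempty ι with _ | ⟨⟨i₀⟩⟩
  · exact ⟨0, 0, Or.inl rfl, fun i => isEmptyElim i⟩
  · refine ⟨x i₀ % 2, fun i => (x i - x i₀ % 2) / 2, by omega, fun i => ?_⟩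
    have := h i i₀
    dsimp only
    omega

variable [Fintype ι]

/-- The number of nonzero coordinates of a ternary word. -/
def hammingWt (w : ι → ZMod 3) : ℕ := ∑ i, if w i = 0 then 0 else 1

/-- Integer vectors that reduce into `T` modulo `3` and, modulo `4`, into the Klemm-type code of
words with all entries of equal parity and entry sum `0`. -/
def klemmLattice (T : Submodule (ZMod 3) (ι → ZMod 3)) : Submodule ℤ (ι → ℤ) where
  carrier := {x | reduce 3 x ∈ T ∧ (∀ i j, 2 ∣ x i - x j) ∧ 4 ∣ ∑ i, x i}
  zero_mem' := by simp
  add_mem' := by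
    rintro x y ⟨h₁, h₂, h₃⟩ ⟨k₁, k₂, k₃⟩
    refine ⟨by simpa using T.add_mem h₁ k₁, fun i j => ?_, ?_⟩
    · have := dvd_add (h₂ i j) (k₂ i j)
      simpa [add_sub_add_comm] using this
    · simpa [Finset.sum_add_distrib] using dvd_add h₃ k₃
  smul_mem' := by
    rintro a x ⟨h₁, h₂, h₃⟩
    refine ⟨?_, fun i j => ?_, ?_⟩
    · rw [map_smul, ← Int.cast_smul_eq_zsmul (ZMod 3)]
      exact T.smul_mem _ h₁
    · simpa [mul_sub] using (h₂ i j).mul_left a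
    · simpa [Finset.mul_sum] using h₃.mul_left a

lemma mem_klemmLattice {T : Submodule (ZMod 3) (ι → ZMod 3)} {x : ι → ℤ} :
    x ∈ klemmLattice T ↔ reduce 3 x ∈ T ∧ (∀ i j, 2 ∣ x i - x j) ∧ 4 ∣ ∑ i, x i := Iff.rfl

/-- The `ℤ₁₂`-code obtained by gluing `T` with the Klemm-type code. -/
def klemmCode (T : Submodule (ZMod 3) (ι → ZMod 3)) :
    Submodule (ZMod (2 * 6)) (ι → ZMod (2 * 6)) where
  carrier := {c | ∃ x ∈ klemmLattice T, reduce (2 * 6) x = c}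
  zero_mem' := ⟨0, zero_mem _, map_zero _⟩
  add_mem' := by
    rintro _ _ ⟨x, hx, rfl⟩ ⟨y, hy, rfl⟩
    exact ⟨x + y, add_mem hx hy, map_add _ _ _⟩
  smul_mem' := by
    rintro a _ ⟨x, hx, rfl⟩
    refine ⟨(a.val : ℤ) • x, Submodule.smul_mem _ _ hx, ?_⟩
    rw [map_smul, ← Int.cast_smul_eq_zsmul (ZMod (2 * 6))]
    simp

lemma mem_klemmLattice_of_reduce_eq {T : Submodule (ZMod 3) (ι → ZMod 3)} {x y : ι → ℤ}
    (hx : x ∈ klemmLattice T) (h : reduce (2 * 6) x = reduce (2 * 6) y) :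
    y ∈ klemmLattice T := by
  choose q hq using dvd_sub_of_reduce_eq h
  have hy : y = x + (12 : ℤ) • q := by
    ext i
    have := hq i
    push_cast at this
    simp
    linarith
  rw [hy]
  refine add_mem hx (mem_klemmLattice.2 ⟨?_, fun i j => ?_, ?_⟩)
  · convert T.zero_mem using 1
    ext i
    simp [show (12 : ZMod 3) = 0 from rfl]
  · simp only [Pi.smul_apply, smul_eq_mul]
    omega
  · simp only [Pi.smul_apply, smul_eq_mul, ← Finset.mul_sum]
    omega

lemma reduce_mem_klemmCode {T : Submodule (ZMod 3) (ι → ZMod 3)} {x : ι → ℤ} :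
    reduce (2 * 6) x ∈ klemmCode T ↔ x ∈ klemmLattice T :=
  ⟨fun ⟨_, hy, h⟩ => mem_klemmLattice_of_reduce_eq hy h, fun h => ⟨x, h, rfl⟩⟩

lemma euclWt_eq_sum_sq (c : ι → ZMod (2 * 6)) : (euclWt c : ℤ) = ∑ i, minLift c i ^ 2 := by
  have key : ∀ a : ZMod (2 * 6),
      ((min (a.val ^ 2) ((2 * 6 - a.val) ^ 2) : ℕ) : ℤ) = a.valMinAbs ^ 2 := by decide
  simp only [euclWt, Nat.cast_sum, minLift, key]

lemma euclWt_reduce {x : ι → ℤ} (h₁ : ∀ i, -6 < x i) (h₂ : ∀ i, x i ≤ 6) :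
    (euclWt (reduce (2 * 6) x) : ℤ) = ∑ i, x i ^ 2 := by
  rw [euclWt_eq_sum_sq]
  refine Finset.sum_congr rfl fun i _ => ?_
  congr 1
  refine (ZMod.valMinAbs_spec _ _).2 ⟨by simp, ?_⟩
  have := h₁ i
  have := h₂ i
  constructor <;> push_cast <;> omega

lemma ternary_dot_dvd {T : Submodule (ZMod 3) (ι → ZMod 3)} (hT : IsSelfDualCode T)
    {x y : ι → ℤ} (hx : reduce 3 x ∈ T) (hy : reduce 3 y ∈ T) : (3 : ℤ) ∣ ∑ i, x i * y i := by
  have h : reduce 3 x ∈ dualCode T := by rw [← hT]; exact hx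
  have := h _ hy
  rw [← Nat.cast_ofNat (n := 3), ← ZMod.intCast_zmod_eq_zero_iff_dvd]
  simpa using this

lemma four_dvd_dot (hn : 8 ∣ Fintype.card ι) {x y : ι → ℤ}
    (hx : ∀ i j, 2 ∣ x i - x j) (hx' : 4 ∣ ∑ i, x i)
    (hy : ∀ i j, 2 ∣ y i - y j) (hy' : 4 ∣ ∑ i, y i) : (4 : ℤ) ∣ ∑ i, x i * y i := by
  obtain ⟨p, u, hp, hu⟩ := exists_parity hx
  obtain ⟨q, v, hq, hv⟩ := exists_parity hy
  obtain ⟨k, hk⟩ := hn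
  simp only [hu, hv, Finset.sum_add_distrib, ← Finset.mul_sum, Finset.sum_const,
    Finset.card_univ, hk, nsmul_eq_mul] at hx' hy'
  have e : ∑ i, x i * y i = 8 * k * (p * q) + 2 * p * ∑ i, v i + 2 * q * ∑ i, u i +
      4 * ∑ i, u i * v i := by
    simp only [hu, hv, Finset.mul_sum]
    rw [show (8 * k * (p * q) : ℤ) = ∑ _i : ι, p * q by simp [hk]]
    rw [← Finset.sum_add_distrib, ← Finset.sum_add_distrib, ← Finset.sum_add_distrib]
    exact Finset.sum_congr rfl fun i _ => by ring
  push_cast at hx' hy'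
  rw [e]
  rcases hp with rfl | rfl <;> rcases hq with rfl | rfl <;> omega

lemma twentyFour_dvd_sum_sq (hn : 8 ∣ Fintype.card ι) {T : Submodule (ZMod 3) (ι → ZMod 3)}
    (hT : IsSelfDualCode T) {x : ι → ℤ} (hx : x ∈ klemmLattice T) :
    (24 : ℤ) ∣ ∑ i, x i ^ 2 := by
  obtain ⟨h₁, h₂, h₃⟩ := hx
  have three := ternary_dot_dvd hT h₁ h₁
  obtain ⟨p, u, hp, hu⟩ := exists_parity h₂
  obtain ⟨k, hk⟩ := hn
  have heven : (2 : ℤ) ∣ ∑ i, (u i ^ 2 - u i) := by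
    refine Finset.dvd_sum fun i _ => ?_
    rw [sq, ← mul_sub_one, mul_comm]
    have := Int.even_mul_succ_self (u i - 1)
    rw [sub_add_cancel] at this
    exact this.two_dvd
  simp only [hu, Finset.sum_add_distrib, ← Finset.mul_sum, Finset.sum_const,
    Finset.card_univ, hk, nsmul_eq_mul] at h₃
  rw [Finset.sum_sub_distrib] at heven
  have e : ∑ i, x i ^ 2 = 8 * k * (p * p) + 4 * p * ∑ i, u i + 4 * ∑ i, u i ^ 2 := by
    simp only [hu, Finset.mul_sum]
    rw [show (8 * k * (p * p) : ℤ) = ∑ _i : ι, p * p by simp [hk]]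
    rw [← Finset.sum_add_distrib, ← Finset.sum_add_distrib]
    exact Finset.sum_congr rfl fun i _ => by ring
  push_cast at h₃
  simp only [← sq] at three
  rcases hp with rfl | rfl <;> omega

lemma isSelfDualCode_klemmCode (hn : 8 ∣ Fintype.card ι)
    {T : Submodule (ZMod 3) (ι → ZMod 3)} (hT : IsSelfDualCode T) :
    IsSelfDualCode (klemmCode T) := by
  classical
  have dot (x y : ι → ℤ) : ∑ i, reduce (2 * 6) x i * reduce (2 * 6) y i = 0 ↔
      (12 : ℤ) ∣ ∑ i, x i * y i := by
    have := ZMod.intCast_zmod_eq_zero_iff_dvd (∑ i, x i * y i) (2 * 6)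
    push_cast at this
    simpa using this
  ext c
  constructor
  · rintro ⟨x, hx, rfl⟩ _ ⟨y, hy, rfl⟩
    rw [dot]
    have h₃ := ternary_dot_dvd hT hx.1 hy.1
    have h₄ := four_dvd_dot hn hx.2.1 hx.2.2 hy.2.1 hy.2.2
    omega
  · intro hc
    obtain ⟨x, rfl⟩ : ∃ x, reduce (2 * 6) x = c := ⟨_, reduce_minLift c⟩
    have hx (y : ι → ℤ) (hy : y ∈ klemmLattice T) : (12 : ℤ) ∣ ∑ i, x i * y i :=
      (dot x y).1 (hc _ ⟨y, hy, rfl⟩)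
    refine ⟨x, ⟨?_, fun i j => ?_, ?_⟩, rfl⟩
    · rw [← SetLike.mem_coe, hT]
      intro w hw
      have lift : reduce 3 (fun i => (w i).valMinAbs) = w := by ext; simp
      have := hx ((4 : ℤ) • fun i => (w i).valMinAbs) (by
        refine ⟨?_, fun i j => ?_, ?_⟩
        · rw [map_smul, lift, ← Int.cast_smul_eq_zsmul (ZMod 3)]
          exact T.smul_mem _ hw
        · simp only [Pi.smul_apply, smul_eq_mul]; omega
        · simp only [Pi.smul_apply, smul_eq_mul, ← Finset.mul_sum]; omega)
      simp only [Pi.smul_apply, smul_eq_mul, mul_left_comm _ (4 : ℤ), ← Finset.mul_sum] at this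
      have h3 : ((3 : ℕ) : ℤ) ∣ ∑ i, x i * (w i).valMinAbs := by push_cast; omega
      rw [← ZMod.intCast_zmod_eq_zero_iff_dvd] at h3
      simpa using h3
    · have := hx (Pi.single i 6 - Pi.single j 6) (by
        refine ⟨?_, fun a b => ?_, ?_⟩
        · convert T.zero_mem using 1
          ext a
          simp only [reduce_apply, Pi.sub_apply, Pi.single_apply]
          split_ifs <;> rfl
        · simp only [Pi.sub_apply, Pi.single_apply]
          split_ifs <;> omega
        · simp)
      simp [mul_sub, Pi.single_apply] at this
      omega
    · have := hx (fun _ => 3) (by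
        refine ⟨?_, fun a b => by simp, ?_⟩
        · convert T.zero_mem using 1
          ext a
          exact (by decide : ((3 : ℤ) : ZMod 3) = 0)
        · obtain ⟨k, hk⟩ := hn
          simp [hk]
          omega)
      rw [← Finset.sum_mul] at this
      omega

lemma isTypeII_klemmCode (hn : 8 ∣ Fintype.card ι)
    {T : Submodule (ZMod 3) (ι → ZMod 3)} (hT : IsSelfDualCode T) :
    IsTypeII 6 (klemmCode T) := by
  refine ⟨isSelfDualCode_klemmCode hn hT, fun c hc => ?_⟩
  rw [← reduce_minLift c, reduce_mem_klemmCode] at hc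
  have := twentyFour_dvd_sum_sq hn hT hc
  rw [← euclWt_eq_sum_sq] at this
  omega

lemma hammingWt_reduce_le (y : ι → ℤ) : (hammingWt (reduce 3 y) : ℤ) ≤ ∑ i, y i ^ 2 := by
  rw [hammingWt, Nat.cast_sum]
  refine Finset.sum_le_sum fun i _ => ?_
  split_ifs with h
  · simpa using sq_nonneg (y i)
  · have : y i ≠ 0 := by rintro h0; simp [h0] at h
    have := sq_pos_of_ne_zero this
    push_cast
    omega

/-- A ternary self-dual code without words of weight at most `s`, and without bad words of full
weight, yields a code of minimum Euclidean weight at least `4 * s + 24`. -/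
lemma le_sum_sq_of_mem {s : ℕ} (hs : s ≤ 12) (hs6 : 6 ∣ s) (hn : 8 ∣ Fintype.card ι)
    {T : Submodule (ZMod 3) (ι → ZMod 3)} (hT : IsSelfDualCode T)
    (hwt : ∀ w ∈ T, hammingWt w ≤ s → w = 0)
    (hcard : 4 * s < Fintype.card ι ∨ 4 * s = Fintype.card ι ∧
      ∀ x : ι → ℤ, (∀ i, x i = 1 ∨ x i = -1) → reduce 3 x ∈ T → ¬ 4 ∣ ∑ i, x i)
    {x : ι → ℤ} (hx : x ∈ klemmLattice T) (hx0 : x ≠ 0) :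
    4 * (s : ℤ) + 24 ≤ ∑ i, x i ^ 2 := by
  by_contra! hlt
  have h24 := twentyFour_dvd_sum_sq hn hT hx
  have hpos : 0 < ∑ i, x i ^ 2 := by
    obtain ⟨i, hi⟩ := Function.ne_iff.1 hx0
    exact Finset.sum_pos' (fun i _ => sq_nonneg _) ⟨i, Finset.mem_univ i, sq_pos_of_ne_zero hi⟩
  obtain ⟨h₁, h₂, h₃⟩ := hx
  obtain ⟨p, y, rfl | rfl, hy⟩ := exists_parity h₂
  · obtain rfl : x = (2 : ℤ) • y := by ext i; simp [hy]
    simp only [Pi.smul_apply, smul_eq_mul, mul_pow, ← Finset.mul_sum] at h24 hlt hpos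
    have hyT : reduce 3 y ∈ T := by
      rw [map_smul, ← Int.cast_smul_eq_zsmul (ZMod 3)] at h₁
      have := T.smul_mem 2 h₁
      rwa [smul_smul, show (2 : ZMod 3) * ((2 : ℤ) : ZMod 3) = 1 from rfl, one_smul] at this
    have h0 := hwt _ hyT (by have := hammingWt_reduce_le y; omega)
    have h9 : (9 : ℤ) ∣ ∑ i, y i ^ 2 := by
      refine Finset.dvd_sum fun i _ => ?_
      have h3 : ((3 : ℕ) : ℤ) ∣ y i := (ZMod.intCast_zmod_eq_zero_iff_dvd _ _).1 (congrFun h0 i)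
      simpa using pow_dvd_pow_of_dvd h3 2
    omega
  · have hone (i : ι) : 0 ≤ x i ^ 2 - 1 := by
      have : x i ≠ 0 := by have := hy i; omega
      have := sq_pos_of_ne_zero this
      omega
    have hsum : ∑ i, (x i ^ 2 - 1) = ∑ i, x i ^ 2 - Fintype.card ι := by
      simp [Finset.sum_sub_distrib]
    have hnn := Finset.sum_nonneg fun i (_ : i ∈ Finset.univ) => hone i
    obtain hc | ⟨hc, hfull⟩ := hcard
    · omega
    · refine hfull x (fun i => ?_) h₁ h₃
      have h0 : ∑ i, (x i ^ 2 - 1) = 0 := by omega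
      have := (Finset.sum_eq_zero_iff_of_nonneg fun i _ => hone i).1 h0 i (Finset.mem_univ i)
      exact mul_self_eq_one_iff.1 (by rw [← sq]; omega)

lemma minEuclWt_klemmCode {s : ℕ} (hs : s ≤ 12) (hs6 : 6 ∣ s) (hn : 8 ∣ Fintype.card ι)
    {T : Submodule (ZMod 3) (ι → ZMod 3)} (hT : IsSelfDualCode T)
    (hwt : ∀ w ∈ T, hammingWt w ≤ s → w = 0)
    (hcard : 4 * s < Fintype.card ι ∨ 4 * s = Fintype.card ι ∧
      ∀ x : ι → ℤ, (∀ i, x i = 1 ∨ x i = -1) → reduce 3 x ∈ T → ¬ 4 ∣ ∑ i, x i)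
    (hmin : ∃ x ∈ klemmLattice T, (∀ i, -6 < x i) ∧ (∀ i, x i ≤ 6) ∧
      ∑ i, x i ^ 2 = 4 * (s : ℤ) + 24) :
    minEuclWt (klemmCode T) = 4 * s + 24 := by
  obtain ⟨x, hx, h₁, h₂, h₃⟩ := hmin
  have hxw := euclWt_reduce h₁ h₂
  refine IsLeast.csInf_eq ⟨⟨_, reduce_mem_klemmCode.2 hx, fun h0 => ?_, by omega⟩, ?_⟩
  · rw [h0] at hxw
    simp [euclWt] at hxw
    omega
  · rintro _ ⟨c, hc, hc0, rfl⟩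
    rw [← reduce_minLift c, reduce_mem_klemmCode] at hc
    have := le_sum_sq_of_mem hs hs6 hn hT hwt hcard hc fun h => hc0 (by
      rw [← reduce_minLift c, h, map_zero])
    rw [← euclWt_eq_sum_sq] at this
    omega

lemma exists_typeII_of_equiv {κ : Type*} [Fintype κ] (e : ι ≃ κ) {k d : ℕ}
    (h : ∃ C : Submodule (ZMod (2 * k)) (ι → ZMod (2 * k)), IsTypeII k C ∧ minEuclWt C = d) :
    ∃ C : Submodule (ZMod (2 * k)) (κ → ZMod (2 * k)), IsTypeII k C ∧ minEuclWt C = d := by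
  obtain ⟨C, ⟨hC, hdvd⟩, hd⟩ := h
  have hwt (c : κ → ZMod (2 * k)) : euclWt (c ∘ e) = euclWt c :=
    e.sum_comp fun j => min ((c j).val ^ 2) ((2 * k - (c j).val) ^ 2)
  have hsymm (c : ι → ZMod (2 * k)) : (c ∘ e.symm) ∘ e = c := by ext; simp
  refine ⟨C.comap (LinearMap.funLeft _ _ e), ⟨?_, fun c hc => ?_⟩, ?_⟩
  · ext x
    change x ∘ e ∈ (C : Set _) ↔ _
    rw [hC]
    constructor
    · intro hx y hy
      rw [← e.sum_comp]
      exact hx _ hy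
    · intro hx y hy
      have := hx (y ∘ e.symm) (by
        change (y ∘ e.symm) ∘ e ∈ C
        rwa [hsymm])
      rw [← e.sum_comp] at this
      simpa using this
  · rw [← hwt]
    exact hdvd _ hc
  · rw [← hd, minEuclWt, minEuclWt]
    congr 1
    ext w
    constructor
    · rintro ⟨c, hc, h0, rfl⟩
      exact ⟨c ∘ e, hc, fun h => h0 (by
        ext j
        simpa using congrFun h (e.symm j)), hwt c⟩
    · rintro ⟨c, hc, h0, rfl⟩
      refine ⟨c ∘ e.symm, ?_, fun h => h0 (by
        ext i
        simpa using congrFun h (e i)), by rw [← hwt, hsymm]⟩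
      change (c ∘ e.symm) ∘ e ∈ C
      rwa [hsymm]

/-! ### Bit-sliced enumeration of ternary words -/

lemma trit_cases : ∀ a : ZMod 3, a = 0 ∨ a = 1 ∨ a = -1 := by decide

/-- Bit planes of a batch of ternary digits: bit `i` of `z`, `p`, `n` records whether lane `i`
carries the digit `0`, `1`, `-1`. -/
structure TritPlanes where
  z : ℕ
  p : ℕ
  n : ℕ

namespace TritPlanes

/-- The batch consisting of a single lane carrying `0`. -/
def unit : TritPlanes := ⟨1, 0, 0⟩

/-- Add the constant `c` to every lane. -/
def rot : SignType → TritPlanes → TritPlanes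
  | .zero, P => P
  | .pos, P => ⟨P.n, P.z, P.p⟩
  | .neg, P => ⟨P.p, P.n, P.z⟩

/-- Subtract the constant `c` from every lane. -/
def rotNeg : SignType → TritPlanes → TritPlanes
  | .zero, P => P
  | .pos, P => ⟨P.p, P.n, P.z⟩
  | .neg, P => ⟨P.n, P.z, P.p⟩

/-- Put the lanes of `Q` behind the first `k` lanes of `P`. -/
def append (P : TritPlanes) (k : ℕ) (Q : TritPlanes) : TritPlanes :=
  ⟨Nat.lor P.z (Nat.shiftLeft Q.z k), Nat.lor P.p (Nat.shiftLeft Q.p k),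
    Nat.lor P.n (Nat.shiftLeft Q.n k)⟩

/-- Lane `i` of `P` carries `v`. -/
def Rep (P : TritPlanes) (i : ℕ) (v : ZMod 3) : Prop :=
  P.z.testBit i = decide (v = 0) ∧ P.p.testBit i = decide (v = 1) ∧ P.n.testBit i = decide (v = -1)

/-- All lanes of `P` from `k` on are empty. -/
def Bounded (P : TritPlanes) (k : ℕ) : Prop :=
  ∀ i, k ≤ i → P.z.testBit i = false ∧ P.p.testBit i = false ∧ P.n.testBit i = false

lemma rep_unit : Rep unit 0 0 := ⟨by decide, by decide, by decide⟩

lemma bounded_unit : Bounded unit 1 := by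
  intro i hi
  have : Nat.testBit 1 i = false := by
    rw [← Bool.not_eq_true, Nat.testBit_one_eq_true_iff_self_eq_zero]
    omega
  simp [unit, this]

lemma Rep.rot {P : TritPlanes} {i : ℕ} {v : ZMod 3} (h : Rep P i v) (c : SignType) :
    Rep (rot c P) i (v + c) := by
  obtain ⟨h₁, h₂, h₃⟩ := h
  rcases trit_cases v with rfl | rfl | rfl <;> cases c <;>
    simp only [Rep, TritPlanes.rot, h₁, h₂, h₃] <;> decide

lemma Rep.rotNeg {P : TritPlanes} {i : ℕ} {v : ZMod 3} (h : Rep P i v) (c : SignType) :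
    Rep (rotNeg c P) i (v - c) := by
  obtain ⟨h₁, h₂, h₃⟩ := h
  rcases trit_cases v with rfl | rfl | rfl <;> cases c <;>
    simp only [Rep, TritPlanes.rotNeg, h₁, h₂, h₃] <;> decide

lemma Bounded.rot {P : TritPlanes} {k : ℕ} (h : Bounded P k) (c : SignType) :
    Bounded (rot c P) k := by
  intro i hi
  obtain ⟨h₁, h₂, h₃⟩ := h i hi
  cases c <;> simp [TritPlanes.rot, h₁, h₂, h₃]

lemma Bounded.rotNeg {P : TritPlanes} {k : ℕ} (h : Bounded P k) (c : SignType) :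
    Bounded (rotNeg c P) k := by
  intro i hi
  obtain ⟨h₁, h₂, h₃⟩ := h i hi
  cases c <;> simp [TritPlanes.rotNeg, h₁, h₂, h₃]

lemma testBit_lor_shiftLeft (a b k i : ℕ) : (Nat.lor a (Nat.shiftLeft b k)).testBit i =
    (a.testBit i || (decide (k ≤ i) && b.testBit (i - k))) := by
  change (a ||| b <<< k).testBit i = _
  rw [Nat.testBit_lor, Nat.testBit_shiftLeft]

lemma Rep.append_left {P : TritPlanes} {i k : ℕ} {v : ZMod 3} (h : Rep P i v) (hi : i < k)
    (Q : TritPlanes) : Rep (P.append k Q) i v := by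
  have : ¬ k ≤ i := by omega
  simpa [Rep, TritPlanes.append, testBit_lor_shiftLeft, this] using h

lemma Rep.append_right {Q : TritPlanes} {i k : ℕ} {v : ZMod 3} (h : Rep Q i v) {P : TritPlanes}
    (hP : Bounded P k) : Rep (P.append k Q) (k + i) v := by
  obtain ⟨h₁, h₂, h₃⟩ := hP (k + i) (by omega)
  simpa [Rep, TritPlanes.append, testBit_lor_shiftLeft, h₁, h₂, h₃] using h

lemma Bounded.append {P Q : TritPlanes} {k l : ℕ} (hP : Bounded P k) (hQ : Bounded Q l) :
    Bounded (P.append k Q) (k + l) := by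
  intro i hi
  obtain ⟨h₁, h₂, h₃⟩ := hP i (by omega)
  obtain ⟨h₄, h₅, h₆⟩ := hQ (i - k) (by omega)
  simp [TritPlanes.append, h₁, h₂, h₃, h₄, h₅, h₆]

end TritPlanes

open TritPlanes

/-- `k n`, written so that the kernel evaluates `n` before passing it on. -/
def force (n : ℕ) (k : ℕ → Bool) : Bool :=
  match Nat.add n 1 with
  | 0 => k n
  | m + 1 => k m

@[simp] lemma force_eq (n : ℕ) (k : ℕ → Bool) : force n k = k n := rfl

/-- `k c`, written so that the kernel evaluates `c` before passing it on. -/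
def forceTrit : SignType → (SignType → Bool) → Bool
  | .zero, k => k .zero
  | .pos, k => k .pos
  | .neg, k => k .neg

@[simp] lemma forceTrit_eq (c : SignType) (k : SignType → Bool) : forceTrit c k = k c := by
  cases c <;> rfl

/-- `k (s, P)`, written so that the kernel evaluates all numbers before passing them on. -/
def forceBatch : ℕ × TritPlanes → (ℕ × TritPlanes → Bool) → Bool
  | (s, ⟨z, p, n⟩), k => force s fun s => force z fun z => force p fun p => force n fun n =>
      k (s, ⟨z, p, n⟩)

@[simp] lemma forceBatch_eq (E : ℕ × TritPlanes) (k : ℕ × TritPlanes → Bool) :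
    forceBatch E k = k E := rfl

/-- Given the batches `E₁`, `E₀` of values of words of weight at most `t + 1`, `t`, the batch of
values after prepending a digit whose generator entry is `c`. -/
def merge (c : SignType) (E₁ E₀ : ℕ × TritPlanes) : ℕ × TritPlanes :=
  (Nat.add E₁.1 (Nat.add E₀.1 E₀.1),
    E₁.2.append E₁.1 ((rot c E₀.2).append E₀.1 (rotNeg c E₀.2)))

/-- The batch of all values `∑ xᵢ cᵢ` with `x` of weight at most `t`. -/
def batch : List SignType → ℕ → ℕ × TritPlanes
  | [], _ => (1, unit)
  | _ :: _, 0 => (1, unit)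
  | c :: cs, t + 1 => merge c (batch cs (t + 1)) (batch cs t)

/-- The batches for the weights `t, t - 1, …, 0`. -/
def batches (cs : List SignType) : ℕ → List (ℕ × TritPlanes)
  | 0 => [batch cs 0]
  | t + 1 => batch cs (t + 1) :: batches cs t

/-- The batches of `c :: cs` from those of `cs`. -/
def batchStep (c : SignType) : List (ℕ × TritPlanes) → (List (ℕ × TritPlanes) → Bool) → Bool
  | E₁ :: E₀ :: L, k => forceBatch (merge c E₁ E₀) fun E => batchStep c (E₀ :: L) fun L' =>
      k (E :: L')
  | L, k => k L

/-- Efficient evaluation of `k (batches cs t)`. -/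
def withBatches (t : ℕ) : List SignType → (List (ℕ × TritPlanes) → Bool) → Bool
  | [], k => k (batches [] t)
  | c :: cs, k => withBatches t cs fun L => forceTrit c fun c => batchStep c L k

lemma batchStep_batches (c : SignType) (cs : List SignType) (t : ℕ)
    (k : List (ℕ × TritPlanes) → Bool) :
    batchStep c (batches cs t) k = k (batches (c :: cs) t) := by
  induction t generalizing k with
  | zero => cases cs <;> rfl
  | succ t ih =>
    have h : ∀ L : List (ℕ × TritPlanes), batches cs t = batch cs t :: L →
        batchStep c (batches cs (t + 1)) k = k (batches (c :: cs) (t + 1)) := by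
      intro L hL
      rw [batches, hL, batchStep, forceBatch_eq, ← hL, ih]
      rfl
    cases t with
    | zero => exact h [] rfl
    | succ t => exact h _ rfl

lemma withBatches_eq (t : ℕ) (cs : List SignType) (k : List (ℕ × TritPlanes) → Bool) :
    withBatches t cs k = k (batches cs t) := by
  induction cs generalizing k with
  | nil => rfl
  | cons c cs ih => simp [withBatches, ih, batchStep_batches]

/-- The value `∑ xᵢ cᵢ`. -/
def dot : List (ZMod 3) → List SignType → ZMod 3
  | a :: x, c :: cs => a * c + dot x cs
  | _, _ => 0

/-- The number of nonzero digits. -/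
def listWt : List (ZMod 3) → ℕ
  | [] => 0
  | a :: x => (if a = 0 then 0 else 1) + listWt x

lemma dot_eq_zero {x : List (ZMod 3)} (hx : listWt x = 0) (cs : List SignType) : dot x cs = 0 := by
  induction x generalizing cs with
  | nil => simp [dot]
  | cons a x ih =>
    cases cs with
    | nil => simp [dot]
    | cons c cs =>
      simp only [listWt, Nat.add_eq_zero_iff, ite_eq_left_iff, one_ne_zero, imp_false,
        not_not] at hx
      simp [dot, hx.1, ih hx.2]

/-- The number of lanes of `batch cs t` for `cs` of length `n`. -/
def batchSize : ℕ → ℕ → ℕ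
  | 0, _ => 1
  | _ + 1, 0 => 1
  | n + 1, t + 1 => batchSize n (t + 1) + (batchSize n t + batchSize n t)

lemma batch_fst (cs : List SignType) (t : ℕ) : (batch cs t).1 = batchSize cs.length t := by
  induction cs generalizing t with
  | nil => rfl
  | cons c cs ih =>
    cases t with
    | zero => rfl
    | succ t => simp [batch, merge, ih, batchSize]

lemma bounded_batch (cs : List SignType) (t : ℕ) : Bounded (batch cs t).2 (batch cs t).1 := by
  induction cs generalizing t with
  | nil => exact bounded_unit
  | cons c cs ih =>
    cases t with
    | zero => exact bounded_unit
    | succ t => exact (ih _).append (((ih _).rot c).append ((ih _).rotNeg c))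

lemma exists_lane_batch (x : List (ZMod 3)) (t : ℕ) (hx : listWt x ≤ t) :
    ∃ i < batchSize x.length t, ∀ cs : List SignType, cs.length = x.length →
      Rep (batch cs t).2 i (dot x cs) := by
  induction x generalizing t with
  | nil =>
    refine ⟨0, by simp [batchSize], fun cs hcs => ?_⟩
    rw [List.length_eq_zero_iff.1 hcs]
    exact rep_unit
  | cons a x ih =>
    cases t with
    | zero =>
      refine ⟨0, by simp [batchSize], fun cs hcs => ?_⟩
      rw [dot_eq_zero (by omega)]
      cases cs <;> exact rep_unit
    | succ t =>
      rw [listWt] at hx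
      have key : ∀ {P : ℕ → Prop}, (∃ i < batchSize (a :: x).length (t + 1), P i) =
          ∃ i < batchSize x.length (t + 1) + (batchSize x.length t + batchSize x.length t),
            P i := rfl
      rw [key]
      have hb : ∀ cs : List SignType, cs.length = x.length → ∀ t,
          (batch cs t).1 = batchSize x.length t := fun cs h t => by rw [batch_fst, h]
      rcases trit_cases a with rfl | rfl | rfl
      · obtain ⟨i, hi, h⟩ := ih (t + 1) (by simpa using hx)
        refine ⟨i, by omega, fun cs hcs => ?_⟩
        obtain _ | ⟨c, cs⟩ := cs
        · simp at hcs
        · have hcs : cs.length = x.length := by simpa using hcs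
          rw [dot, zero_mul, zero_add]
          exact (h cs hcs).append_left (by rwa [hb cs hcs]) _
      · obtain ⟨i, hi, h⟩ := ih t (by simp at hx; omega)
        refine ⟨batchSize x.length (t + 1) + i, by omega, fun cs hcs => ?_⟩
        obtain _ | ⟨c, cs⟩ := cs
        · simp at hcs
        · have hcs : cs.length = x.length := by simpa using hcs
          rw [← hb cs hcs, dot, one_mul, add_comm (c : ZMod 3)]
          exact (((h cs hcs).rot c).append_left ((hb cs hcs t).symm ▸ hi) _).append_right
            (bounded_batch _ _)
      · obtain ⟨i, hi, h⟩ := ih t (by simp at hx; omega)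
        refine ⟨batchSize x.length (t + 1) + (batchSize x.length t + i), by omega,
          fun cs hcs => ?_⟩
        obtain _ | ⟨c, cs⟩ := cs
        · simp at hcs
        · have hcs : cs.length = x.length := by simpa using hcs
          rw [← hb cs hcs, ← hb cs hcs, dot, neg_one_mul, neg_add_eq_sub]
          exact (((h cs hcs).rotNeg c).append_right ((bounded_batch _ _).rot c)).append_right
            (bounded_batch _ _)

/-- The planes of zeros, column by column, for all words with first digit `1` and at most `t`
further nonzero digits. -/
def zeroPlanes (t : ℕ) : List (List SignType) → (List ℕ → Bool) → Bool
  | [], k => k []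
  | [] :: _, _ => false
  | (c :: cs) :: cols, k => withBatches t cs fun
      | [] => false
      | E :: _ => forceTrit c fun c => force (rot c E.2).z fun z =>
          zeroPlanes t cols fun zs => k (z :: zs)

/-- The number of planes having bit `i` set. -/
def laneCount (l : List ℕ) (i : ℕ) : ℕ := (l.map fun a => (a.testBit i).toNat).sum

/-- The number of columns on which `x` vanishes. -/
def zeroCount (x : List (ZMod 3)) (cols : List (List SignType)) : ℕ :=
  (cols.map fun col => if dot x col = 0 then 1 else 0).sum

lemma exists_of_zeroPlanes {t : ℕ} {cols : List (List SignType)} {k : List ℕ → Bool}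
    (h : zeroPlanes t cols k = true) : ∃ zs, k zs = true ∧
      ∀ (x : List (ZMod 3)) (i : ℕ), (∀ col ∈ cols, col.length = x.length + 1) →
        (∀ cs : List SignType, cs.length = x.length → Rep (batch cs t).2 i (dot x cs)) →
        laneCount zs i = zeroCount (1 :: x) cols := by
  induction cols generalizing k with
  | nil => exact ⟨[], h, fun _ _ _ _ => rfl⟩
  | cons col cols ih =>
    obtain _ | ⟨c, cs⟩ := col
    · simp [zeroPlanes] at h
    · have h' : zeroPlanes t cols (fun zs => k ((rot c (batch cs t).2).z :: zs)) = true := by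
        cases t <;> simpa [zeroPlanes, withBatches_eq, batches] using h
      obtain ⟨zs, hk, hz⟩ := ih h'
      refine ⟨_, hk, fun x i hl hx => ?_⟩
      have h₁ := hz x i (fun col hcol => hl col (List.mem_cons_of_mem _ hcol)) hx
      have h₂ := ((hx cs (by simpa using hl (c :: cs) List.mem_cons_self)).rot c).1
      simp only [laneCount, zeroCount, List.map_cons, List.sum_cons] at h₁ ⊢
      rw [h₁, h₂, dot, one_mul, add_comm (dot x cs)]
      split_ifs with h₃ <;> simp [h₃]

/-- Carry-save addition of bit planes: the plane of sum bits and the list of carry planes. -/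
def carrySave : ℕ → List ℕ → (ℕ → List ℕ → Bool) → Bool
  | a, [], k => k a []
  | a, [x], k => force (Nat.xor a x) fun s => force (Nat.land a x) fun c => k s [c]
  | a, x :: y :: l, k =>
      force (Nat.xor a x) fun t => force (Nat.xor t y) fun s =>
        force (Nat.lor (Nat.land a x) (Nat.land t y)) fun c => carrySave s l fun s' cs =>
          k s' (c :: cs)

lemma testBit_xor' (a b i : ℕ) : (Nat.xor a b).testBit i = (a.testBit i ^^ b.testBit i) :=
  Nat.testBit_xor a b i

lemma testBit_land' (a b i : ℕ) : (Nat.land a b).testBit i = (a.testBit i && b.testBit i) :=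
  Nat.testBit_and a b i

lemma testBit_lor' (a b i : ℕ) : (Nat.lor a b).testBit i = (a.testBit i || b.testBit i) :=
  Nat.testBit_or a b i

lemma exists_of_carrySave {a : ℕ} {l : List ℕ} {k : ℕ → List ℕ → Bool}
    (h : carrySave a l k = true) : ∃ s cs, k s cs = true ∧
      ∀ i, (a.testBit i).toNat + laneCount l i = (s.testBit i).toNat + 2 * laneCount cs i := by
  induction a, l, k using carrySave.induct with
  | case1 a k => exact ⟨a, [], h, fun i => rfl⟩
  | case2 a x k =>
    refine ⟨_, _, h, fun i => ?_⟩
    simp only [laneCount, List.map_cons, List.map_nil, List.sum_cons, List.sum_nil, testBit_xor',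
      testBit_land']
    cases a.testBit i <;> cases x.testBit i <;> rfl
  | case3 a x y l k ih =>
    obtain ⟨s, cs, hk, hs⟩ := ih _ _ h
    refine ⟨s, _, hk, fun i => ?_⟩
    have := hs i
    simp only [laneCount, List.map_cons, List.sum_cons, testBit_xor', testBit_land',
      testBit_lor'] at this ⊢
    revert this
    cases a.testBit i <;> cases x.testBit i <;> cases y.testBit i <;> simp <;> omega

/-- Lane-wise population count: the binary digits of the count, least significant first. -/
def popCount : ℕ → List ℕ → (List ℕ → Bool) → Bool
  | _, [], k => k []
  | 0, _ :: _, _ => false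
  | f + 1, x :: l, k => carrySave x l fun s cs => popCount f cs fun bs => k (s :: bs)

/-- The number in lane `i` with binary digits `bs`, least significant first. -/
def laneValue : List ℕ → ℕ → ℕ
  | [], _ => 0
  | b :: bs, i => (b.testBit i).toNat + 2 * laneValue bs i

lemma exists_of_popCount {f : ℕ} {l : List ℕ} {k : List ℕ → Bool}
    (h : popCount f l k = true) : ∃ bs, k bs = true ∧ ∀ i, laneValue bs i = laneCount l i := by
  induction f generalizing l k with
  | zero =>
    cases l with
    | nil => exact ⟨[], h, fun i => rfl⟩
    | cons x l => simp [popCount] at h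
  | succ f ih =>
    cases l with
    | nil => exact ⟨[], h, fun i => rfl⟩
    | cons x l =>
      obtain ⟨s, cs, hk, hs⟩ := exists_of_carrySave h
      obtain ⟨bs, hk', hb⟩ := ih hk
      refine ⟨_, hk', fun i => ?_⟩
      rw [laneValue, hb, ← hs]
      simp [laneCount]

/-- The lanes whose number with binary digits `bs`, least significant first, exceeds `K`; the
plane `acc` holds the outcome for the digits already treated. -/
def exceedMask : List ℕ → ℕ → ℕ → ℕ
  | [], K, acc => bif Nat.beq K 0 then acc else 0
  | b :: bs, K, acc => exceedMask bs (Nat.div K 2)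
      (bif Nat.beq (Nat.mod K 2) 1 then Nat.land b acc else Nat.lor b acc)

lemma testBit_exceedMask (bs : List ℕ) (K acc i : ℕ) : (exceedMask bs K acc).testBit i = true ↔
    K < laneValue bs i ∨ K = laneValue bs i ∧ acc.testBit i = true := by
  induction bs generalizing K acc with
  | nil =>
    cases K with
    | zero => simp [exceedMask, laneValue]
    | succ K => simp [exceedMask, laneValue, show Nat.beq (K + 1) 0 = false from rfl]
  | cons b bs ih =>
    rw [exceedMask, ih, laneValue, show Nat.div K 2 = K / 2 from rfl,
      show Nat.mod K 2 = K % 2 from rfl]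
    rcases Nat.mod_two_eq_zero_or_one K with hK | hK <;> rw [hK] <;>
      simp only [show Nat.beq 0 1 = false from rfl, show Nat.beq 1 1 = true from rfl, cond_true,
        cond_false, testBit_land', testBit_lor'] <;>
      cases b.testBit i <;> cases acc.testBit i <;>
      simp only [Bool.and_true, Bool.and_false, Bool.or_true, Bool.or_false, Bool.toNat_true,
        Bool.toNat_false, eq_self, reduceCtorEq, and_true, and_false, or_false] <;> omega

/-- No word with first digit `1` and at most `t` further nonzero digits vanishes on more than `K`
columns. -/
def sparseCheck (t K : ℕ) (cols : List (List SignType)) : Bool :=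
  zeroPlanes t cols fun zs => popCount 8 zs fun bs => Nat.beq (exceedMask bs K 0) 0

lemma zeroCount_le_of_sparseCheck {t K : ℕ} {cols : List (List SignType)}
    (h : sparseCheck t K cols = true) {x : List (ZMod 3)} (hx : listWt x ≤ t)
    (hl : ∀ col ∈ cols, col.length = x.length + 1) : zeroCount (1 :: x) cols ≤ K := by
  obtain ⟨zs, h₁, hz⟩ := exists_of_zeroPlanes h
  obtain ⟨bs, h₂, hb⟩ := exists_of_popCount h₁
  obtain ⟨i, -, hi⟩ := exists_lane_batch x t hx
  rw [← hz x i hl hi, ← hb]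
  by_contra! hK
  have := (testBit_exceedMask bs K 0 i).2 (.inl hK)
  rw [Nat.eq_of_beq_eq_true h₂] at this
  simp at this

/-- The batch of all values `∑ xᵢ cᵢ` with `xᵢ = ±1`. -/
def signBatch : List SignType → ℕ × TritPlanes
  | [] => (1, unit)
  | c :: cs => (Nat.add (signBatch cs).1 (signBatch cs).1,
      (rot c (signBatch cs).2).append (signBatch cs).1 (rotNeg c (signBatch cs).2))

/-- Efficient evaluation of `k (signBatch cs)`. -/
def withSignBatch : List SignType → (ℕ × TritPlanes → Bool) → Bool
  | [], k => k (1, unit)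
  | c :: cs, k => withSignBatch cs fun E => forceTrit c fun c =>
      forceBatch (Nat.add E.1 E.1, (rot c E.2).append E.1 (rotNeg c E.2)) k

lemma withSignBatch_eq (cs : List SignType) (k : ℕ × TritPlanes → Bool) :
    withSignBatch cs k = k (signBatch cs) := by
  induction cs generalizing k with
  | nil => rfl
  | cons c cs ih => simp [withSignBatch, ih, signBatch]

lemma signBatch_fst (cs : List SignType) : (signBatch cs).1 = 2 ^ cs.length := by
  induction cs with
  | nil => rfl
  | cons c cs ih =>
    rw [signBatch, List.length_cons, pow_succ, mul_two, ← ih]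
    rfl

lemma bounded_signBatch (cs : List SignType) : Bounded (signBatch cs).2 (signBatch cs).1 := by
  induction cs with
  | nil => exact bounded_unit
  | cons c cs ih => exact (ih.rot c).append (ih.rotNeg c)

lemma exists_lane_signBatch (x : List (ZMod 3)) (hx : ∀ a ∈ x, a ≠ 0) :
    ∃ i < 2 ^ x.length, ∀ cs : List SignType, cs.length = x.length →
      Rep (signBatch cs).2 i (dot x cs) := by
  induction x with
  | nil =>
    refine ⟨0, by simp, fun cs hcs => ?_⟩
    rw [List.length_eq_zero_iff.1 hcs]
    exact rep_unit
  | cons a x ih =>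
    obtain ⟨i, hi, h⟩ := ih fun b hb => hx b (List.mem_cons_of_mem _ hb)
    have ha : a = 1 ∨ a = -1 := (trit_cases a).resolve_left (hx a List.mem_cons_self)
    simp only [List.length_cons, pow_succ, mul_two]
    rcases ha with rfl | rfl
    · refine ⟨i, by omega, fun cs hcs => ?_⟩
      obtain _ | ⟨c, cs⟩ := cs
      · simp at hcs
      · have hcs : cs.length = x.length := by simpa using hcs
        rw [dot, one_mul, add_comm]
        exact ((h cs hcs).rot c).append_left (by rwa [signBatch_fst, hcs]) _
    · refine ⟨2 ^ x.length + i, by omega, fun cs hcs => ?_⟩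
      obtain _ | ⟨c, cs⟩ := cs
      · simp at hcs
      · have hcs : cs.length = x.length := by simpa using hcs
        rw [dot, neg_one_mul, neg_add_eq_sub, ← hcs, ← signBatch_fst]
        exact ((h cs hcs).rotNeg c).append_right ((bounded_signBatch _).rot c)

/-- Every word with digits `±1` and first digit `1` vanishes on some column or takes the value `-1`
on an odd number of columns. The first three planes hold the lanes in use, those having met a zero,
and those having met an odd number of values `-1`. -/
def signCheck : List (List SignType) → ℕ → ℕ → ℕ → Bool
  | [], u, v, w => Nat.beq (Nat.lor v w) u
  | [] :: _, _, _, _ => false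
  | (c :: cs) :: cols, u, v, w => withSignBatch cs fun E => forceTrit c fun c =>
      match rot c E.2 with
      | ⟨z, p, n⟩ => force (Nat.lor u (Nat.lor z (Nat.lor p n))) fun u =>
          force (Nat.lor v z) fun v => force (Nat.xor w n) fun w => signCheck cols u v w

/-- The number of columns on which `x` takes the value `-1`. -/
def negCount (x : List (ZMod 3)) (cols : List (List SignType)) : ℕ :=
  (cols.map fun col => if dot x col = -1 then 1 else 0).sum

lemma testBit_of_signCheck {cols : List (List SignType)} {u v w : ℕ}
    (h : signCheck cols u v w = true) {x : List (ZMod 3)} {i : ℕ}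
    (hl : ∀ col ∈ cols, col.length = x.length + 1)
    (hx : ∀ cs : List SignType, cs.length = x.length → Rep (signBatch cs).2 i (dot x cs))
    (hz : ∀ col ∈ cols, dot (1 :: x) col ≠ 0) :
    (v.testBit i || (w.testBit i ^^ decide (negCount (1 :: x) cols % 2 = 1))) =
      (u.testBit i || !cols.isEmpty) := by
  induction cols generalizing u v w with
  | nil =>
    rw [signCheck] at h
    have h := Nat.eq_of_beq_eq_true h
    simp [← h, negCount]
  | cons col cols ih =>
    obtain _ | ⟨c, cs⟩ := col
    · simp [signCheck] at h
    · have h' := ih (by simpa only [signCheck, withSignBatch_eq, forceTrit_eq, force_eq] using h)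
        (fun col hcol => hl col (List.mem_cons_of_mem _ hcol))
        (fun col hcol => hz col (List.mem_cons_of_mem _ hcol))
      obtain ⟨h₁, h₂, h₃⟩ := (hx cs (by simpa using hl (c :: cs) List.mem_cons_self)).rot c
      have h₀ := hz (c :: cs) List.mem_cons_self
      have hn : negCount (1 :: x) ((c :: cs) :: cols) =
          (if dot x cs + c = -1 then 1 else 0) + negCount (1 :: x) cols := by
        simp [negCount, dot, add_comm]
      rw [dot, one_mul, add_comm] at h₀
      rw [hn]
      simp only [testBit_lor', testBit_xor', h₁, h₂, h₃] at h'
      generalize dot x cs + (c : ZMod 3) = a at *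
      have h₄ : (1 : ZMod 3) ≠ -1 := by decide
      rcases (trit_cases a).resolve_left h₀ with rfl | rfl
      · simpa [h₄] using h'
      · rcases Nat.mod_two_eq_zero_or_one (negCount (1 :: x) cols) with hm | hm
        · have : (1 + negCount (1 :: x) cols) % 2 = 1 := by omega
          simpa [hm, this] using h'
        · have : (1 + negCount (1 :: x) cols) % 2 = 0 := by omega
          simpa [hm, this] using h'

lemma odd_negCount_of_signCheck {cols : List (List SignType)} (hc : cols ≠ [])
    (h : signCheck cols 0 0 0 = true) {x : List (ZMod 3)} (hx : ∀ a ∈ x, a ≠ 0)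
    (hl : ∀ col ∈ cols, col.length = x.length + 1) (hz : ∀ col ∈ cols, dot (1 :: x) col ≠ 0) :
    negCount (1 :: x) cols % 2 = 1 := by
  obtain ⟨i, -, hi⟩ := exists_lane_signBatch x hx
  have hc : cols.isEmpty = false := by simpa using hc
  simpa [hc] using testBit_of_signCheck h hl hi hz

/-! ### Negacirculant matrices -/

/-- The columns of a matrix. -/
def columns {m n : ℕ} (S : Matrix (Fin m) (Fin n) SignType) : List (List SignType) :=
  List.ofFn fun j => List.ofFn fun i => S i j

/-- A matrix of signs, read over `ℤ/3ℤ`. -/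
def ternary {m n : ℕ} (S : Matrix (Fin m) (Fin n) SignType) : Matrix (Fin m) (Fin n) (ZMod 3) :=
  S.map fun c => (c : ZMod 3)

@[simp] lemma ternary_apply {m n : ℕ} (S : Matrix (Fin m) (Fin n) SignType) (i : Fin m)
    (j : Fin n) : ternary S i j = (S i j : ZMod 3) := rfl

lemma dot_ofFn {n : ℕ} (x : Fin n → ZMod 3) (c : Fin n → SignType) :
    dot (List.ofFn x) (List.ofFn c) = ∑ i, x i * (c i : ZMod 3) := by
  induction n with
  | zero => simp [dot]
  | succ n ih => simp [List.ofFn_succ, dot, ih, Fin.sum_univ_succ]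

lemma listWt_ofFn {n : ℕ} (x : Fin n → ZMod 3) : listWt (List.ofFn x) = hammingWt x := by
  induction n with
  | zero => simp [listWt, hammingWt]
  | succ n ih =>
    rw [List.ofFn_succ, listWt, ih, hammingWt, hammingWt, Fin.sum_univ_succ]

lemma sum_columns {m n : ℕ} (S : Matrix (Fin m) (Fin n) SignType) (x : Fin m → ZMod 3)
    (f : ZMod 3 → ℕ) : ((columns S).map fun col => f (dot (List.ofFn x) col)).sum =
      ∑ j, f (Matrix.vecMul x (ternary S) j) := by
  simp only [columns, List.map_ofFn, List.sum_ofFn, Function.comp_def, dot_ofFn]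
  rfl

lemma length_of_mem_columns {m n : ℕ} {S : Matrix (Fin m) (Fin n) SignType}
    {col : List SignType} (h : col ∈ columns S) : col.length = m := by
  obtain ⟨j, rfl⟩ := List.mem_ofFn.1 h
  simp

lemma ternary_one {n : ℕ} : ternary (1 : Matrix (Fin n) (Fin n) SignType) = 1 := by
  ext i j
  by_cases h : i = j <;> simp [Matrix.one_apply, h]

lemma hammingWt_add_zeros {ι : Type*} [Fintype ι] (w : ι → ZMod 3) :
    hammingWt w + ∑ i, (if w i = 0 then 1 else 0) = Fintype.card ι := by
  rw [hammingWt, ← Finset.sum_add_distrib, Fintype.card_eq_sum_ones]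
  refine Finset.sum_congr rfl fun i _ => ?_
  split_ifs <;> rfl

/-- The negacirculant matrix with first row `l`. -/
def negacirculant (m : ℕ) (l : List SignType) : Matrix (Fin m) (Fin m) SignType :=
  fun i j => if (i : ℕ) ≤ j then l.getD (j - i) 0 else -l.getD (m + j - i) 0

/-- The sign picked up by position `i` under the negacyclic shift. -/
def wrapSign {n : ℕ} (i : Fin (n + 1)) : ZMod 3 := if i = Fin.last n then -1 else 1

@[simp] lemma wrapSign_mul_self {n : ℕ} (i : Fin (n + 1)) : wrapSign i * wrapSign i = 1 := by
  rw [wrapSign]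
  split_ifs <;> decide

lemma wrapSign_ne_zero {n : ℕ} (i : Fin (n + 1)) : wrapSign i ≠ 0 := fun h => by
  simpa [h] using wrapSign_mul_self i

@[simp] lemma wrapSign_castSucc {n : ℕ} (i : Fin n) : wrapSign i.castSucc = 1 := by
  rw [wrapSign, if_neg (Fin.castSucc_ne_last i)]

lemma ternary_negacirculant_add_one {n : ℕ} (l : List SignType) (i j : Fin (n + 1)) :
    ternary (negacirculant (n + 1) l) (i + 1) (j + 1) =
      wrapSign i * wrapSign j * ternary (negacirculant (n + 1) l) i j := by
  simp only [ternary_apply, negacirculant, wrapSign]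
  rcases Fin.eq_castSucc_or_eq_last i with ⟨i, rfl⟩ | rfl <;>
    rcases Fin.eq_castSucc_or_eq_last j with ⟨j, rfl⟩ | rfl
  · have h₁ : (j : ℕ) + 1 - (i + 1) = j - i := by omega
    have h₂ : n + 1 + ((j : ℕ) + 1) - (i + 1) = n + 1 + j - i := by omega
    simp [Fin.coeSucc_eq_succ, h₁, h₂, Fin.castSucc_ne_last]
  · have h₁ : n + 1 - ((i : ℕ) + 1) = n - i := by omega
    have h₂ : (i : ℕ) ≤ n := by omega
    simp [Fin.coeSucc_eq_succ, h₁, h₂, Fin.castSucc_ne_last]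
  · have h₁ : n + 1 + (j : ℕ) - n = j + 1 := by omega
    have h₂ : ¬ n ≤ (j : ℕ) := by omega
    simp [Fin.coeSucc_eq_succ, h₁, h₂, Fin.castSucc_ne_last]
  · simp

lemma negacirculant_rev {n : ℕ} (l : List SignType) (i j : Fin n) :
    negacirculant n l i.rev j.rev = negacirculant n l j i := by
  simp only [negacirculant, Fin.val_rev]
  have h₁ : n - ((i : ℕ) + 1) ≤ n - (j + 1) ↔ (j : ℕ) ≤ i := by omega
  have h₂ : n - ((j : ℕ) + 1) - (n - (i + 1)) = i - j := by omega
  have h₃ : n + (n - ((j : ℕ) + 1)) - (n - (i + 1)) = n + i - j := by omega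
  simp only [h₁, h₂, h₃]

lemma negacirculant_mul_transpose {n : ℕ} {l : List SignType}
    (h : ∀ j, ∑ k, ternary (negacirculant (n + 1) l) 0 k * ternary (negacirculant (n + 1) l) j k =
      if j = 0 then -1 else 0) :
    ternary (negacirculant (n + 1) l) * (ternary (negacirculant (n + 1) l)).transpose = -1 := by
  set A := ternary (negacirculant (n + 1) l) with hA
  have hshift (i j : Fin (n + 1)) : A (i + 1) (j + 1) = wrapSign i * wrapSign j * A i j :=
    ternary_negacirculant_add_one l i j
  have hG (i j : Fin (n + 1)) : (A * A.transpose) i j = ∑ k, A i k * A j k := rfl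
  have hsucc (i j : Fin n) :
      ∑ k, A i.succ k * A j.succ k = ∑ k, A i.castSucc k * A j.castSucc k := by
    rw [← Equiv.sum_comp (Equiv.addRight (1 : Fin (n + 1)))]
    refine Finset.sum_congr rfl fun k _ => ?_
    simp only [Equiv.coe_addRight, ← Fin.coeSucc_eq_succ, hshift, wrapSign_castSucc]
    linear_combination (A i.castSucc k * A j.castSucc k) * wrapSign_mul_self k
  have key : ∀ i j, ∑ k, A i k * A j k = if j = i then -1 else 0 := by
    intro i
    induction i using Fin.induction with
    | zero => exact h
    | succ i ih =>
      intro j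
      cases j using Fin.cases with
      | zero =>
        rw [if_neg (Fin.succ_ne_zero i).symm]
        simpa [mul_comm] using h i.succ
      | succ j => simp [hsucc, ih]
  ext i j
  rw [hG, key]
  by_cases hij : i = j <;> simp [hij, eq_comm]

lemma exists_leading_one {n : ℕ} (l : List SignType) {x : Fin (n + 1) → ZMod 3} (hx : x ≠ 0) :
    ∃ y : Fin (n + 1) → ZMod 3, y 0 = 1 ∧ hammingWt y = hammingWt x ∧
      hammingWt (Matrix.vecMul y (ternary (negacirculant (n + 1) l))) =
        hammingWt (Matrix.vecMul x (ternary (negacirculant (n + 1) l))) := by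
  set A := ternary (negacirculant (n + 1) l) with hA
  obtain ⟨i, hi⟩ := Function.ne_iff.1 hx
  induction i using Fin.induction generalizing x with
  | zero =>
    have hi' : x 0 ≠ 0 := hi
    refine ⟨x 0 • x, ?_, ?_, ?_⟩
    · rcases (trit_cases (x 0)).resolve_left hi with h | h <;> simp [h]
    · simp [hammingWt, hi']
    · simp [hammingWt, Matrix.smul_vecMul, hi']
  | succ i ih =>
    let z : Fin (n + 1) → ZMod 3 := fun i => wrapSign i * x (i + 1)
    have hzA : Matrix.vecMul z A = fun j => wrapSign j * Matrix.vecMul x A (j + 1) := by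
      ext j
      simp only [Matrix.vecMul, dotProduct, z, Finset.mul_sum]
      symm
      rw [← Equiv.sum_comp (Equiv.addRight (1 : Fin (n + 1)))]
      refine Finset.sum_congr rfl fun k _ => ?_
      simp only [Equiv.coe_addRight, hA, ternary_negacirculant_add_one]
      linear_combination (wrapSign k * x (k + 1) * A k j) * wrapSign_mul_self j
    have hwt (w : Fin (n + 1) → ZMod 3) :
        hammingWt (fun j => wrapSign j * w (j + 1)) = hammingWt w := by
      simp only [hammingWt, mul_eq_zero, wrapSign_ne_zero, false_or]
      exact Equiv.sum_comp (Equiv.addRight (1 : Fin (n + 1))) fun j => if w j = 0 then 0 else 1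
    have hzi : z i.castSucc ≠ 0 := by
      simpa [z, Fin.coeSucc_eq_succ] using hi
    obtain ⟨y, h₁, h₂, h₃⟩ := ih (x := z) (fun h => hzi (by rw [h]; rfl)) hzi
    exact ⟨y, h₁, h₂.trans (hwt x), h₃.trans (by rw [hzA, hwt])⟩

/-- Every word of weight between `1` and `s / 2` with first digit `1` is mapped by `S` to a word
such that the two weights add up to more than `s`. -/
def weightCheck {m : ℕ} (s : ℕ) (S : Matrix (Fin m) (Fin m) SignType) : Bool :=
  (List.range (s / 2)).all fun t => sparseCheck t (m + t - s) (columns S)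

lemma lt_hammingWt_add {n s : ℕ} {l : List SignType} (hs : s ≤ n + 1)
    (h : weightCheck s (negacirculant (n + 1) l) = true) {x : Fin (n + 1) → ZMod 3} (hx : x ≠ 0)
    (hxs : hammingWt x ≤ s / 2) :
    s < hammingWt x + hammingWt (Matrix.vecMul x (ternary (negacirculant (n + 1) l))) := by
  obtain ⟨y, hy, h₁, h₂⟩ := exists_leading_one l hx
  rw [← h₁, ← h₂]
  have hlist : List.ofFn y = 1 :: List.ofFn fun i : Fin n => y i.succ := by
    rw [List.ofFn_succ, hy]
  have hwt := listWt_ofFn y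
  rw [hlist, listWt, if_neg one_ne_zero] at hwt
  have hcheck := List.all_eq_true.1 h (listWt (List.ofFn fun i : Fin n => y i.succ))
    (List.mem_range.2 (by omega))
  have hzero := zeroCount_le_of_sparseCheck hcheck le_rfl fun col hcol => by
    simp [length_of_mem_columns hcol]
  rw [← hlist, zeroCount, sum_columns _ y fun a => if a = 0 then 1 else 0] at hzero
  have := hammingWt_add_zeros (Matrix.vecMul y (ternary (negacirculant (n + 1) l)))
  rw [Fintype.card_fin] at this
  omega

/-! ### Double negacirculant codes -/

/-- The ternary code with generator matrix `(1 | A)`. -/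
def doubleCode {n : ℕ} (A : Matrix (Fin n) (Fin n) (ZMod 3)) :
    Submodule (ZMod 3) (Fin n ⊕ Fin n → ZMod 3) where
  carrier := {w | w ∘ Sum.inr = Matrix.vecMul (w ∘ Sum.inl) A}
  zero_mem' := (Matrix.zero_vecMul A).symm
  add_mem' := by
    intro v w hv hw
    change v ∘ Sum.inr + w ∘ Sum.inr = Matrix.vecMul (v ∘ Sum.inl + w ∘ Sum.inl) A
    rw [Matrix.add_vecMul, hv, hw]
  smul_mem' := by
    intro a w hw
    change a • (w ∘ Sum.inr) = Matrix.vecMul (a • (w ∘ Sum.inl)) A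
    rw [Matrix.smul_vecMul, hw]

lemma mem_doubleCode {n : ℕ} {A : Matrix (Fin n) (Fin n) (ZMod 3)} {w : Fin n ⊕ Fin n → ZMod 3} :
    w ∈ doubleCode A ↔ w ∘ Sum.inr = Matrix.vecMul (w ∘ Sum.inl) A := Iff.rfl

lemma isSelfDualCode_doubleCode {n : ℕ} {A : Matrix (Fin n) (Fin n) (ZMod 3)}
    (hA : A * A.transpose = -1) : IsSelfDualCode (doubleCode A) := by
  have hA' : A.transpose * A = -1 := by
    have : -A.transpose * A = 1 := mul_eq_one_comm.1 (by rw [mul_neg, hA, neg_neg])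
    rw [← this, neg_mul, neg_neg]
  have hsum (v w : Fin n ⊕ Fin n → ZMod 3) : ∑ i, v i * w i =
      (v ∘ Sum.inl) ⬝ᵥ (w ∘ Sum.inl) + (v ∘ Sum.inr) ⬝ᵥ (w ∘ Sum.inr) :=
    Fintype.sum_sum_type _
  ext w
  simp only [dualCode, Set.mem_ofPred_eq, SetLike.mem_coe, hsum, mem_doubleCode]
  constructor
  · intro hw v hv
    rw [hw, hv, ← Matrix.dotProduct_mulVec, ← Matrix.vecMul_transpose, Matrix.vecMul_vecMul, hA,
      Matrix.vecMul_neg, Matrix.vecMul_one, dotProduct_neg, add_neg_cancel]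
  · intro hw
    have key : w ∘ Sum.inl = -Matrix.mulVec A (w ∘ Sum.inr) := by
      refine eq_neg_of_add_eq_zero_left (dotProduct_eq_zero _ fun x => ?_)
      have := hw (Sum.elim x (Matrix.vecMul x A)) (by simp)
      rw [Sum.elim_comp_inl, Sum.elim_comp_inr] at this
      rw [add_dotProduct, dotProduct_comm (Matrix.mulVec _ _), Matrix.dotProduct_mulVec,
        dotProduct_comm _ (w ∘ Sum.inr)]
      exact this
    rw [key, Matrix.neg_vecMul, ← Matrix.vecMul_transpose, Matrix.vecMul_vecMul, hA',
      Matrix.vecMul_neg, Matrix.vecMul_one, neg_neg]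

lemma eq_zero_of_hammingWt_le {n s : ℕ} {l : List SignType} (hs : s ≤ n + 1)
    (hA : ternary (negacirculant (n + 1) l) * (ternary (negacirculant (n + 1) l)).transpose = -1)
    (h : weightCheck s (negacirculant (n + 1) l) = true) {w : Fin (n + 1) ⊕ Fin (n + 1) → ZMod 3}
    (hw : w ∈ doubleCode (ternary (negacirculant (n + 1) l))) (hws : hammingWt w ≤ s) : w = 0 := by
  set A := ternary (negacirculant (n + 1) l) with hAdef
  obtain ⟨x, y, rfl⟩ : ∃ x y, w = Sum.elim x y := ⟨_, _, (Sum.elim_comp_inl_inr w).symm⟩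
  rw [mem_doubleCode, Sum.elim_comp_inl, Sum.elim_comp_inr] at hw
  have hsum : hammingWt (Sum.elim x y) = hammingWt x + hammingWt y := Fintype.sum_sum_type _
  rw [hsum] at hws
  have hyA : Matrix.vecMul y A.transpose = -x := by
    rw [hw, Matrix.vecMul_vecMul, hA, Matrix.vecMul_neg, Matrix.vecMul_one]
  have hrevA : Matrix.vecMul (y ∘ Fin.rev) A = -(x ∘ Fin.rev) := by
    ext j
    have := congrFun hyA j.rev
    simp only [Matrix.vecMul, dotProduct, Matrix.transpose_apply, Pi.neg_apply,
      Function.comp_apply] at this ⊢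
    rw [← this, ← Equiv.sum_comp Fin.revPerm]
    refine Finset.sum_congr rfl fun i _ => ?_
    rw [Fin.revPerm_apply, Fin.rev_rev, hAdef, ternary_apply, ternary_apply,
      ← negacirculant_rev l i j.rev, Fin.rev_rev]
  have hrev (v : Fin (n + 1) → ZMod 3) : hammingWt (v ∘ Fin.rev) = hammingWt v :=
    Equiv.sum_comp Fin.revPerm fun i => if v i = 0 then 0 else 1
  have hneg (v : Fin (n + 1) → ZMod 3) : hammingWt (-v) = hammingWt v := by simp [hammingWt]
  by_contra h0
  have hx : x ≠ 0 := by
    rintro rfl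
    rw [Matrix.zero_vecMul] at hw
    exact h0 (by rw [hw]; ext (i | i) <;> rfl)
  have hy : y ∘ Fin.rev ≠ 0 := by
    intro hy
    rw [hy, Matrix.zero_vecMul, eq_comm, neg_eq_zero] at hrevA
    refine hx (funext fun i => ?_)
    simpa using congrFun hrevA i.rev
  have h₁ := lt_hammingWt_add hs h hx
  have h₂ := lt_hammingWt_add hs h hy
  rw [← hAdef, ← hw] at h₁
  rw [← hAdef, hrevA, hneg, hrev, hrev] at h₂
  omega

lemma not_four_dvd_sum_of_signCheck {n : ℕ} {S : Matrix (Fin (n + 1)) (Fin (n + 1)) SignType}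
    (hn : 2 ∣ n + 1)
    (h : signCheck (columns (1 : Matrix (Fin (n + 1)) (Fin (n + 1)) SignType) ++ columns S) 0 0 0 =
      true)
    {x : Fin (n + 1) ⊕ Fin (n + 1) → ℤ} (hx : ∀ i, x i = 1 ∨ x i = -1)
    (hxT : reduce 3 x ∈ doubleCode (ternary S)) : ¬ 4 ∣ ∑ i, x i := by
  wlog h0 : x (Sum.inl 0) = 1 generalizing x
  · have := this (x := -x) (fun i => by have := hx i; simp only [Pi.neg_apply]; omega)
      (by rw [map_neg]; exact neg_mem hxT)
      (by have := hx (Sum.inl 0); simp only [Pi.neg_apply]; omega)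
    simpa only [Pi.neg_apply, Finset.sum_neg_distrib, dvd_neg] using this
  have hne (i) : (x i : ZMod 3) ≠ 0 := by
    rcases hx i with h | h <;> rw [h] <;> decide
  set a : Fin (n + 1) → ZMod 3 := reduce 3 x ∘ Sum.inl with ha
  have hlist : List.ofFn a = 1 :: List.ofFn fun i : Fin n => a i.succ := by
    rw [List.ofFn_succ]
    simp [ha, h0]
  have hb := mem_doubleCode.1 hxT
  have hdot : ∀ col ∈ columns (1 : Matrix (Fin (n + 1)) (Fin (n + 1)) SignType) ++ columns S,
      dot (List.ofFn a) col ≠ 0 := by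
    intro col hcol
    rcases List.mem_append.1 hcol with hcol | hcol <;> obtain ⟨j, rfl⟩ := List.mem_ofFn.1 hcol <;>
      rw [dot_ofFn]
    · have : ∑ i, a i * (((1 : Matrix _ _ SignType) i j : SignType) : ZMod 3) =
          Matrix.vecMul a (ternary 1) j := rfl
      rw [this, ternary_one, Matrix.vecMul_one]
      exact hne _
    · have : ∑ i, a i * (S i j : ZMod 3) = Matrix.vecMul a (ternary S) j := rfl
      rw [this, ← hb]
      exact hne _
  have hodd := odd_negCount_of_signCheck (x := List.ofFn fun i : Fin n => a i.succ)
    (by simp [columns]) h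
    (fun b hb => by obtain ⟨i, rfl⟩ := List.mem_ofFn.1 hb; exact hne _)
    (fun col hcol => by
      rcases List.mem_append.1 hcol with hcol | hcol <;> simp [length_of_mem_columns hcol])
    (by rwa [← hlist])
  obtain ⟨f, hf⟩ : ∃ f : ZMod 3 → ℕ, f = fun a => if a = -1 then 1 else 0 := ⟨_, rfl⟩
  have hf' (x : List (ZMod 3)) (cols : List (List SignType)) :
      negCount x cols = (cols.map fun col => f (dot x col)).sum := by rw [hf, negCount]
  rw [← hlist, hf', List.map_append, List.sum_append, sum_columns, sum_columns, ternary_one,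
    Matrix.vecMul_one, ← hb] at hodd
  have hterm (i) : x i = 1 - 2 * (f (x i : ZMod 3) : ℤ) := by
    rw [hf]
    rcases hx i with h | h <;> rw [h] <;> decide
  have hsum : ∑ i, x i = 2 * ((n + 1 : ℕ) : ℤ) - 2 *
      ((∑ i, f (a i) + ∑ i, f ((reduce 3 x ∘ Sum.inr) i) : ℕ) : ℤ) := by
    rw [Finset.sum_congr rfl fun i _ => hterm i, Finset.sum_sub_distrib, ← Finset.mul_sum,
      Fintype.sum_sum_type fun i => (f (x i : ZMod 3) : ℤ)]
    simp only [ha, Function.comp_apply, reduce_apply, Finset.sum_const, Finset.card_univ,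
      Fintype.card_sum, Fintype.card_fin]
    push_cast
    ring
  rw [hsum]
  omega

lemma exists_typeII_of_doubleCode {n s : ℕ} {l : List SignType} (hn : 4 ∣ n + 1) (hs : s ≤ 12)
    (hs6 : 6 ∣ s) (hsn : s ≤ n + 1)
    (horth : ∀ j, ∑ k, ternary (negacirculant (n + 1) l) 0 k *
      ternary (negacirculant (n + 1) l) j k = if j = 0 then -1 else 0)
    (hweight : weightCheck s (negacirculant (n + 1) l) = true)
    (hcard : 4 * s < 2 * (n + 1) ∨ 4 * s = 2 * (n + 1) ∧
      signCheck (columns (1 : Matrix (Fin (n + 1)) (Fin (n + 1)) SignType) ++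
        columns (negacirculant (n + 1) l)) 0 0 0 = true)
    (hmin : ∃ x ∈ klemmLattice (doubleCode (ternary (negacirculant (n + 1) l))),
      (∀ i, -6 < x i) ∧ (∀ i, x i ≤ 6) ∧ ∑ i, x i ^ 2 = 4 * (s : ℤ) + 24)
    {N : ℕ} (hN : 2 * (n + 1) = N) :
    ∃ C : Submodule (ZMod (2 * 6)) (Fin N → ZMod (2 * 6)),
      IsTypeII 6 C ∧ minEuclWt C = 4 * s + 24 := by
  have hA := negacirculant_mul_transpose horth
  have hT := isSelfDualCode_doubleCode hA
  have hι : Fintype.card (Fin (n + 1) ⊕ Fin (n + 1)) = 2 * (n + 1) := by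
    rw [Fintype.card_sum, Fintype.card_fin, two_mul]
  have h8 : 8 ∣ Fintype.card (Fin (n + 1) ⊕ Fin (n + 1)) := by omega
  refine exists_typeII_of_equiv (Fintype.equivFinOfCardEq (hι.trans hN))
    ⟨_, isTypeII_klemmCode h8 hT, minEuclWt_klemmCode hs hs6 h8 hT
      (fun w hw => eq_zero_of_hammingWt_le hsn hA hweight hw) ?_ hmin⟩
  rw [hι]
  exact hcard.imp_right fun h => ⟨h.1, fun x hx hxT =>
    not_four_dvd_sum_of_signCheck (by omega) h.2 hx hxT⟩

/-- Twice a lift of the first row of the generator matrix `(1 | A)`. -/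
lemma exists_mem_of_row {n : ℕ} {l : List SignType}
    (hsum : 4 ∣ 2 * (1 + ∑ j, (negacirculant (n + 1) l 0 j : ℤ)))
    (hsq : ∑ j, (negacirculant (n + 1) l 0 j : ℤ) ^ 2 = 11) :
    ∃ x ∈ klemmLattice (doubleCode (ternary (negacirculant (n + 1) l))),
      (∀ i, -6 < x i) ∧ (∀ i, x i ≤ 6) ∧ ∑ i, x i ^ 2 = 4 * ((6 : ℕ) : ℤ) + 24 := by
  set r : Fin (n + 1) → ℤ := fun j => (negacirculant (n + 1) l 0 j : ℤ) with hr
  have hbound (j) : -1 ≤ r j ∧ r j ≤ 1 := by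
    rw [hr]
    dsimp only
    cases negacirculant (n + 1) l 0 j <;> decide
  have hbound' (j : Fin (n + 1)) : 0 ≤ (Pi.single 0 1 : Fin (n + 1) → ℤ) j ∧
      (Pi.single 0 1 : Fin (n + 1) → ℤ) j ≤ 1 := by
    by_cases h : j = 0 <;> simp [h]
  have hcast (j) : ((r j : ℤ) : ZMod 3) = ternary (negacirculant (n + 1) l) 0 j := by
    rw [hr, ternary_apply]
    dsimp only
    cases negacirculant (n + 1) l 0 j <;> decide
  let x : Fin (n + 1) ⊕ Fin (n + 1) → ℤ := fun i => 2 * Sum.elim (Pi.single 0 1) r i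
  have hxl (i) : x (Sum.inl i) = 2 * (Pi.single 0 1 : Fin (n + 1) → ℤ) i := rfl
  have hxr (j) : x (Sum.inr j) = 2 * r j := rfl
  refine ⟨x, ⟨?_, fun i j => ?_, ?_⟩, ?_, ?_, ?_⟩
  · have : reduce 3 x = (2 : ZMod 3) •
        Sum.elim (Pi.single 0 1) (ternary (negacirculant (n + 1) l) 0) := by
      ext (i | j)
      · by_cases h : i = 0 <;> simp [hxl, h]
      · simp [hxr, hcast]
    rw [this]
    refine Submodule.smul_mem _ _ ?_
    rw [mem_doubleCode, Sum.elim_comp_inl, Sum.elim_comp_inr, Matrix.single_one_vecMul]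
    rfl
  · exact dvd_sub (dvd_mul_right _ _) (dvd_mul_right _ _)
  · simpa [hxl, hxr, ← Finset.mul_sum, Fintype.sum_sum_type, mul_add] using hsum
  · rintro (i | j)
    · linarith [hbound' i, hxl i]
    · linarith [hbound j, hxr j]
  · rintro (i | j)
    · linarith [hbound' i, hxl i]
    · linarith [hbound j, hxr j]
  · simp only [Fintype.sum_sum_type, hxl, hxr, mul_pow, ← Finset.mul_sum]
    rw [hsq, Finset.sum_eq_single 0 (fun i _ hi => by simp [hi]) (by simp)]
    simp

lemma exists_mem_of_two_le {n : ℕ} (A : Matrix (Fin (n + 2)) (Fin (n + 2)) (ZMod 3)) :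
    ∃ x ∈ klemmLattice (doubleCode A),
      (∀ i, -6 < x i) ∧ (∀ i, x i ≤ 6) ∧ ∑ i, x i ^ 2 = 4 * ((12 : ℕ) : ℤ) + 24 := by
  let v : Fin (n + 2) → ℤ := Fin.cons 6 (Fin.cons 6 0)
  have hv (i) : v i = 6 ∨ v i = 0 := by
    refine Fin.cases (.inl rfl) (fun i => Fin.cases (.inl rfl) (fun i => .inr rfl) i) i
  let x : Fin (n + 2) ⊕ Fin (n + 2) → ℤ := Sum.elim v 0
  have hx (i) : x i = 6 ∨ x i = 0 := by
    rcases i with i | i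
    · exact hv i
    · exact .inr rfl
  refine ⟨x, ⟨?_, ?_, ?_⟩, ?_, ?_, ?_⟩
  · have : reduce 3 x = 0 := by
      ext i
      rcases hx i with h | h <;> rw [reduce_apply, h, Pi.zero_apply] <;> decide
    rw [this]
    exact zero_mem _
  · intro i j
    have := hx i
    have := hx j
    omega
  · simp [x, v, Fin.sum_univ_succ, Fintype.sum_sum_type]
  · intro i
    have := hx i
    omega
  · intro i
    have := hx i
    omega
  · simp [x, v, Fin.sum_univ_succ, Fintype.sum_sum_type]

/-- The first row for length `32`. -/
def row32 : List SignType :=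
  [-1, -1, 0, 1, 0, 1, 0, 1, 1, 1, -1, -1, -1, 1, 0, 0]

lemma row32_orthogonal : ∀ j, ∑ k, ternary (negacirculant 16 row32) 0 k *
    ternary (negacirculant 16 row32) j k = if j = 0 then -1 else 0 := by
  decide +kernel

lemma weightCheck_row32 : weightCheck 6 (negacirculant 16 row32) = true := by
  decide +kernel

/-- The first row for length `40`. -/
def row40 : List SignType :=
  [-1, -1, 1, 0, -1, 1, 0, -1, -1, 0, -1, 0, 0, 1, 1, 0, 0, 0, 0, -1]

lemma row40_orthogonal : ∀ j, ∑ k, ternary (negacirculant 20 row40) 0 k *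
    ternary (negacirculant 20 row40) j k = if j = 0 then -1 else 0 := by
  decide +kernel

lemma weightCheck_row40 : weightCheck 6 (negacirculant 20 row40) = true := by
  decide +kernel

/-- The first row for length `48`. -/
def row48 : List SignType :=
  [1, -1, 1, -1, 0, 1, -1, 0, -1, -1, -1, 0, 0, 0, -1, 0, 1, 1, -1, 1, 1, 1, 0, -1]

lemma row48_orthogonal : ∀ j, ∑ k, ternary (negacirculant 24 row48) 0 k *
    ternary (negacirculant 24 row48) j k = if j = 0 then -1 else 0 := by
  decide +kernel

lemma weightCheck_row48 : weightCheck 12 (negacirculant 24 row48) = true := by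
  decide +kernel

lemma signCheck_row48 : signCheck (columns (1 : Matrix (Fin 24) (Fin 24) SignType) ++
    columns (negacirculant 24 row48)) 0 0 0 = true := by
  decide +kernel

/-- The first row for length `56`. -/
def row56 : List SignType :=
  [1, 0, 1, -1, -1, 0, 0, -1, 0, 0, 0, 0, -1, -1, -1, 0, 1, 0, 1, 1, 1, -1, -1, -1, 0, -1, -1, 0]

lemma row56_orthogonal : ∀ j, ∑ k, ternary (negacirculant 28 row56) 0 k *
    ternary (negacirculant 28 row56) j k = if j = 0 then -1 else 0 := by
  decide +kernel

lemma weightCheck_row56 : weightCheck 12 (negacirculant 28 row56) = true := by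
  decide +kernel

/-- The first row for length `64`. -/
def row64 : List SignType :=
  [0, 1, 1, -1, 1, 0, 1, 1, -1, 0, 0, 1, 0, 0, -1, 0, 1, 1, 1, -1, 0, -1, -1, 0, 0, 0, 0, 1,
    1, -1, -1, -1]

lemma row64_orthogonal : ∀ j, ∑ k, ternary (negacirculant 32 row64) 0 k *
    ternary (negacirculant 32 row64) j k = if j = 0 then -1 else 0 := by
  decide +kernel

lemma weightCheck_row64 : weightCheck 12 (negacirculant 32 row64) = true := by
  decide +kernel

end ExtremalZ12

open ExtremalZ12 in
/-- extremal Type II ℤ₁₂-codes of length 8m for m = 4,5,6,7,8. -/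
theorem exists_extremal_typeII_Z12 :
    ∀ m ∈ ({4, 5, 6, 7, 8} : Set ℕ),
      ∃ C : Submodule (ZMod (2 * 6)) (Fin (8 * m) → ZMod (2 * 6)),
        IsTypeII 6 C ∧ minEuclWt C = 4 * 6 * ((8 * m) / 24) + 4 * 6 := by
  intro m hm
  simp only [Set.mem_insert_iff, Set.mem_singleton_iff] at hm
  rcases hm with rfl | rfl | rfl | rfl | rfl
  · exact exists_typeII_of_doubleCode (n := 15) (s := 6) (by norm_num) (by norm_num) (by norm_num)
      (by norm_num) row32_orthogonal weightCheck_row32 (.inl (by norm_num))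
      (exists_mem_of_row (by decide +kernel) (by decide +kernel)) rfl
  · exact exists_typeII_of_doubleCode (n := 19) (s := 6) (by norm_num) (by norm_num) (by norm_num)
      (by norm_num) row40_orthogonal weightCheck_row40 (.inl (by norm_num))
      (exists_mem_of_row (by decide +kernel) (by decide +kernel)) rfl
  · exact exists_typeII_of_doubleCode (n := 23) (s := 12) (by norm_num) (by norm_num) (by norm_num)
      (by norm_num) row48_orthogonal weightCheck_row48 (.inr ⟨rfl, signCheck_row48⟩)
      (exists_mem_of_two_le _) rfl
  · exact exists_typeII_of_doubleCode (n := 27) (s := 12) (by norm_num) (by norm_num) (by norm_num)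
      (by norm_num) row56_orthogonal weightCheck_row56 (.inl (by norm_num))
      (exists_mem_of_two_le _) rfl
  · exact exists_typeII_of_doubleCode (n := 31) (s := 12) (by norm_num) (by norm_num) (by norm_num)
      (by norm_num) row64_orthogonal weightCheck_row64 (.inl (by norm_num))
      (exists_mem_of_two_le _) rfl
end

section
/- Let k ≥ 1 and s ≥ 1 be integers and let l be a positive integer with l < s + 2. Let S = {(y, x, x₁, …, x_s) ∈ ℤ^{s+2} : (1 + 2ky)² + (2kx)² + (2kx₁)² + ⋯ + (2kx_s)² = l}. Then S is finite, and if S is nonempty, then Σ_{(y,x,x₁,…,x_s) ∈ S} ((1 + 2ky)² − (2kx)²) > 0. -/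
open scoped BigOperators

/-- An integer is bounded in absolute value by any bound on its square. -/
theorem mem_Icc_neg_of_sq_le {a l : ℤ} (h : a ^ 2 ≤ l) : -l ≤ a ∧ a ≤ l :=
  abs_le.mp ((Int.natCast_natAbs a ▸ Int.natAbs_le_self_sq a).trans h)

theorem mem_Icc_neg_of_sq_mul_le {k : ℕ} (hk : 1 ≤ k) {a l : ℤ}
    (h : (2 * (k : ℤ) * a) ^ 2 ≤ l) : -l ≤ a ∧ a ≤ l := by
  refine mem_Icc_neg_of_sq_le (le_trans ?_ h)
  have hk' : (1 : ℤ) ≤ k := by exact_mod_cast hk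
  rw [mul_pow]
  exact le_mul_of_one_le_left (sq_nonneg a) (by nlinarith)

theorem mem_Icc_neg_of_sq_one_add_mul_le {k : ℕ} (hk : 1 ≤ k) {a l : ℤ}
    (h : (1 + 2 * (k : ℤ) * a) ^ 2 ≤ l) : -l ≤ a ∧ a ≤ l := by
  obtain ⟨h₁, h₂⟩ := mem_Icc_neg_of_sq_le h
  have hk' : (1 : ℤ) ≤ k := by exact_mod_cast hk
  have hl : 0 ≤ l := (sq_nonneg _).trans h
  rcases le_or_gt 0 a with ha | ha
  · constructor <;> nlinarith
  · constructor <;> nlinarith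

theorem one_le_sq_one_add_two_mul (k : ℕ) (y : ℤ) : 1 ≤ (1 + 2 * (k : ℤ) * y) ^ 2 := by
  have h : 1 + 2 * (k : ℤ) * y ≠ 0 := by
    rw [mul_assoc]
    omega
  have := sq_pos_of_ne_zero h
  omega

/-- Exchanging an entry of a family with a separate value preserves the total sum. -/
theorem add_sum_update_eq {ι α M : Type*} [Fintype ι] [DecidableEq ι] [AddCommMonoid M]
    (f : α → M) (g : ι → α) (i : ι) (v : α) :
    f (g i) + ∑ j, f (Function.update g i v j) = f v + ∑ j, f (g j) := by
  rw [← Finset.add_sum_erase _ _ (Finset.mem_univ i),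
    ← Finset.add_sum_erase _ (fun j => f (g j)) (Finset.mem_univ i),
    Finset.sum_congr rfl fun j hj => by
      rw [Function.update_of_ne (Finset.ne_of_mem_erase hj)]]
  simp only [Function.update_self]
  exact add_left_comm _ _ _

/-- For the solution set of `g y + f x + ∑ i, f (z i) = l`, the sums of `f` over the coordinates
`z i` and `x` agree. -/
theorem sum_coord_eq_sum_fst {ι α β : Type*} [Fintype ι] [DecidableEq ι] (f : β → ℤ)
    (g : α → ℤ) (l : ℤ) (T : Finset (α × β × (ι → β)))
    (hT : ∀ p, p ∈ T ↔ g p.1 + f p.2.1 + ∑ i, f (p.2.2 i) = l) (i : ι) :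
    ∑ p ∈ T, f (p.2.2 i) = ∑ p ∈ T, f p.2.1 := by
  have hmem : ∀ p ∈ T, (p.1, p.2.2 i, Function.update p.2.2 i p.2.1) ∈ T := by
    intro p hp
    rw [hT] at hp ⊢
    have := add_sum_update_eq f p.2.2 i p.2.1
    dsimp only
    linarith
  refine Finset.sum_bij' (fun p _ => (p.1, p.2.2 i, Function.update p.2.2 i p.2.1))
    (fun p _ => (p.1, p.2.2 i, Function.update p.2.2 i p.2.1)) hmem hmem ?_ ?_ ?_ <;>
  simp

/-- positivity of the coefficient sum in the proof of the extremal bound. -/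
theorem coeff_sum_pos (k s : ℕ) (hk : 1 ≤ k) (hs : 1 ≤ s) (l : ℤ) (hl : 0 < l)
    (hls : l < (s : ℤ) + 2) :
    (Set.Finite {p : ℤ × ℤ × (Fin s → ℤ) |
        (1 + 2 * (k : ℤ) * p.1) ^ 2 + (2 * (k : ℤ) * p.2.1) ^ 2
          + ∑ i, (2 * (k : ℤ) * p.2.2 i) ^ 2 = l}) ∧
    ∀ hS : Set.Finite {p : ℤ × ℤ × (Fin s → ℤ) |
        (1 + 2 * (k : ℤ) * p.1) ^ 2 + (2 * (k : ℤ) * p.2.1) ^ 2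
          + ∑ i, (2 * (k : ℤ) * p.2.2 i) ^ 2 = l},
      {p : ℤ × ℤ × (Fin s → ℤ) |
        (1 + 2 * (k : ℤ) * p.1) ^ 2 + (2 * (k : ℤ) * p.2.1) ^ 2
          + ∑ i, (2 * (k : ℤ) * p.2.2 i) ^ 2 = l}.Nonempty →
      0 < ∑ p ∈ hS.toFinset,
        ((1 + 2 * (k : ℤ) * p.1) ^ 2 - (2 * (k : ℤ) * p.2.1) ^ 2) := by
  refine ⟨?_, fun hS hne => ?_⟩
  · refine ((Set.finite_Icc (-l) l).prod ((Set.finite_Icc (-l) l).prod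
      (Set.finite_Icc (fun _ : Fin s => -l) fun _ => l))).subset ?_
    rintro ⟨y, x, z⟩ h
    simp only [Set.mem_ofPred_eq] at h
    have hz : ∀ i, (2 * (k : ℤ) * z i) ^ 2 ≤ ∑ j, (2 * (k : ℤ) * z j) ^ 2 := fun i =>
      Finset.single_le_sum (f := fun j => (2 * (k : ℤ) * z j) ^ 2)
        (fun j _ => sq_nonneg _) (Finset.mem_univ i)
    have hsum : 0 ≤ ∑ j, (2 * (k : ℤ) * z j) ^ 2 := Finset.sum_nonneg fun j _ => sq_nonneg _
    have hy2 := sq_nonneg (1 + 2 * (k : ℤ) * y)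
    have hx2 := sq_nonneg (2 * (k : ℤ) * x)
    have hy := mem_Icc_neg_of_sq_one_add_mul_le hk (a := y) (l := l) (by linarith)
    have hx := mem_Icc_neg_of_sq_mul_le hk (a := x) (l := l) (by linarith)
    have hzb := fun i => mem_Icc_neg_of_sq_mul_le hk (a := z i) (l := l) (by linarith [hz i])
    exact ⟨hy, hx, fun i => (hzb i).1, fun i => (hzb i).2⟩
  · have hT := fun p => hS.mem_toFinset (a := p)
    have hne' : hS.toFinset.Nonempty := hS.toFinset_nonempty.mpr hne
    generalize hS.toFinset = T at hT hne' ⊢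
    simp only [Set.mem_ofPred_eq] at hT
    have hsymm := sum_coord_eq_sum_fst (fun b : ℤ => (2 * (k : ℤ) * b) ^ 2)
      (fun a : ℤ => (1 + 2 * (k : ℤ) * a) ^ 2) l T hT
    have htotal : ∑ p ∈ T, ∑ i, (2 * (k : ℤ) * p.2.2 i) ^ 2
        = (s : ℤ) * ∑ p ∈ T, (2 * (k : ℤ) * p.2.1) ^ 2 := by
      rw [Finset.sum_comm, Finset.sum_congr rfl fun i _ => hsymm i]
      simp
    have hkey : ((s : ℤ) + 1) *
        ∑ p ∈ T, ((1 + 2 * (k : ℤ) * p.1) ^ 2 - (2 * (k : ℤ) * p.2.1) ^ 2)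
        = ∑ p ∈ T, (((s : ℤ) + 2) * (1 + 2 * (k : ℤ) * p.1) ^ 2 - l) := by
      have h : ∀ p ∈ T, ((s : ℤ) + 2) * (1 + 2 * (k : ℤ) * p.1) ^ 2 - l
          = ((s : ℤ) + 1) * (1 + 2 * (k : ℤ) * p.1) ^ 2 - (2 * (k : ℤ) * p.2.1) ^ 2
            - ∑ i, (2 * (k : ℤ) * p.2.2 i) ^ 2 := fun p hp => by linarith [(hT p).mp hp]
      rw [Finset.sum_congr rfl h]
      simp only [Finset.sum_sub_distrib, htotal, ← Finset.mul_sum]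
      ring
    have hpos : 0 < ∑ p ∈ T, (((s : ℤ) + 2) * (1 + 2 * (k : ℤ) * p.1) ^ 2 - l) :=
      Finset.sum_pos (fun p _ => by nlinarith [one_le_sq_one_add_two_mul k p.1]) hne'
    rw [← hkey] at hpos
    exact pos_of_mul_pos_right hpos (by positivity)
end

section
/- There exists a 48-dimensional extremal even unimodular lattice L ⊂ ℝ^{48} (i.e., an even unimodular lattice with minimum norm 2·⌊48/24⌋ + 2 = 6) which contains a 10-frame, i.e., vectors f₁, …, f_{48} ∈ L with ⟨fᵢ, fⱼ⟩ = 10·δ_{i,j} for all i, j. -/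
open scoped BigOperators

open Matrix

/-! ### The Paley conference matrix of order 24 and its ternary code -/

/-- The skew conference matrix of order `24`: the index `0` is the point at infinity of the
projective line over `𝔽₂₃`, and `i ≠ 0` stands for the residue `i - 1`. -/
def paley (i j : Fin 24) : ℤ :=
  if i = j then 0 else if i = 0 then 1 else if j = 0 then -1
  else if (j.val + 23 - i.val) % 23 ∈ [1, 2, 3, 4, 6, 8, 9, 12, 13, 16, 18] then 1 else -1

/-- `paley` as a matrix. -/
def paleyMatrix : Matrix (Fin 24) (Fin 24) ℤ := Matrix.of paley

theorem paleyMatrix_transpose : paleyMatrixᵀ = -paleyMatrix := by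
  have h : ∀ i j, paley j i = -paley i j := by decide +kernel
  ext i j
  exact h i j

theorem paleyMatrix_mul_self : paleyMatrix * paleyMatrix = (-23 : ℤ) • 1 := by
  have h : ∀ i j, ∑ k, paley i k * paley k j = if i = j then -23 else 0 := by decide +kernel
  ext i j
  simpa [Matrix.mul_apply, Matrix.one_apply, paleyMatrix] using h i j

theorem vecMul_vecMul_paley (u : Fin 24 → ℤ) :
    (u ᵥ* paleyMatrix) ᵥ* paleyMatrix = (-23 : ℤ) • u := by
  rw [Matrix.vecMul_vecMul, paleyMatrix_mul_self, Matrix.vecMul_smul, Matrix.vecMul_one]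

theorem vecMul_paley_dotProduct (u v : Fin 24 → ℤ) :
    (u ᵥ* paleyMatrix) ⬝ᵥ v = -(u ⬝ᵥ (v ᵥ* paleyMatrix)) := by
  rw [← Matrix.dotProduct_mulVec, ← Matrix.vecMul_transpose, paleyMatrix_transpose,
    Matrix.vecMul_neg, dotProduct_neg]

theorem vecMul_paley_dotProduct_vecMul_paley (u v : Fin 24 → ℤ) :
    (u ᵥ* paleyMatrix) ⬝ᵥ (v ᵥ* paleyMatrix) = 23 * (u ⬝ᵥ v) := by
  rw [vecMul_paley_dotProduct, vecMul_vecMul_paley, dotProduct_smul]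
  simp

/-- The pair `(u, v)` reduces modulo `3` to a codeword of the Pless symmetry code of length `48`. -/
def IsCodeword (u v : Fin 24 → ℤ) : Prop := ∀ j, (3 : ℤ) ∣ v j - (u ᵥ* paleyMatrix) j

theorem IsCodeword.swap {u v : Fin 24 → ℤ} (h : IsCodeword u v) : IsCodeword v u := by
  choose t ht using h
  have hv : v = u ᵥ* paleyMatrix + (3 : ℤ) • t := by
    ext j
    have := ht j
    simp only [Pi.add_apply, Pi.smul_apply, smul_eq_mul]
    linarith
  intro j
  rw [hv, Matrix.add_vecMul, vecMul_vecMul_paley, Matrix.smul_vecMul]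
  refine ⟨8 * u j - (t ᵥ* paleyMatrix) j, ?_⟩
  simp only [Pi.add_apply, Pi.smul_apply, smul_eq_mul]
  ring

theorem IsCodeword.add {u v u' v' : Fin 24 → ℤ} (h : IsCodeword u v) (h' : IsCodeword u' v') :
    IsCodeword (u + u') (v + v') := by
  intro j
  rw [Matrix.add_vecMul, Pi.add_apply, Pi.add_apply, add_sub_add_comm]
  exact dvd_add (h j) (h' j)

theorem IsCodeword.smul {u v : Fin 24 → ℤ} (c : ℤ) (h : IsCodeword u v) :
    IsCodeword (c • u) (c • v) := by
  intro j
  rw [Matrix.smul_vecMul, Pi.smul_apply, Pi.smul_apply, ← smul_sub]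
  exact (h j).mul_left c

theorem IsCodeword.of_smul {u v : Fin 24 → ℤ} {c : ℤ} (hc : IsCoprime 3 c)
    (h : IsCodeword (c • u) (c • v)) : IsCodeword u v := by
  intro j
  have := h j
  rw [Matrix.smul_vecMul, Pi.smul_apply, Pi.smul_apply, ← smul_sub] at this
  exact hc.dvd_of_dvd_mul_left this

theorem IsCodeword.neg {u v : Fin 24 → ℤ} (h : IsCodeword u v) : IsCodeword (-u) (-v) := by
  simpa using h.smul (-1)

theorem IsCodeword.dvd_dotProduct {u v u' v' : Fin 24 → ℤ} (h : IsCodeword u v)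
    (h' : IsCodeword u' v') : (3 : ℤ) ∣ u ⬝ᵥ u' + v ⬝ᵥ v' := by
  choose t ht using h
  choose t' ht' using h'
  have hv : v = u ᵥ* paleyMatrix + (3 : ℤ) • t := by
    ext j
    have := ht j
    simp only [Pi.add_apply, Pi.smul_apply, smul_eq_mul]
    linarith
  have hv' : v' = u' ᵥ* paleyMatrix + (3 : ℤ) • t' := by
    ext j
    have := ht' j
    simp only [Pi.add_apply, Pi.smul_apply, smul_eq_mul]
    linarith
  rw [hv, hv']
  simp only [add_dotProduct, dotProduct_add, smul_dotProduct, dotProduct_smul,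
    vecMul_paley_dotProduct_vecMul_paley, smul_eq_mul]
  exact ⟨8 * (u ⬝ᵥ u') + (u ᵥ* paleyMatrix) ⬝ᵥ t' + (t ⬝ᵥ (u' ᵥ* paleyMatrix) + 3 * (t ⬝ᵥ t')),
    by ring⟩

/-- The number of coordinates that are nonzero modulo `3`. -/
def ternaryWeight (u : Fin 24 → ℤ) : ℕ := ∑ i, if (3 : ℤ) ∣ u i then 0 else 1

theorem ternaryWeight_congr {u v : Fin 24 → ℤ} (h : ∀ i, (3 : ℤ) ∣ u i - v i) :
    ternaryWeight u = ternaryWeight v := by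
  refine Finset.sum_congr rfl fun i _ => ?_
  have := h i
  congr 1
  simp only [eq_iff_iff]
  omega

theorem IsCodeword.ternaryWeight_eq {u v : Fin 24 → ℤ} (h : IsCodeword u v) :
    ternaryWeight v = ternaryWeight (u ᵥ* paleyMatrix) :=
  ternaryWeight_congr h

theorem exists_pair_of_two_lt_ternaryWeight {u : Fin 24 → ℤ} (h : 2 < ternaryWeight u) :
    ∃ i j, i ≠ 0 ∧ j ≠ 0 ∧ i ≠ j ∧ ¬ (3 : ℤ) ∣ u i ∧ ¬ (3 : ℤ) ∣ u j := by
  have hcard : ternaryWeight u = (Finset.univ.filter fun i => ¬ (3 : ℤ) ∣ u i).card := by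
    rw [ternaryWeight, Finset.card_filter]
    exact Finset.sum_congr rfl fun i _ => by split_ifs <;> simp_all
  have h1 : 1 < ((Finset.univ.filter fun i => ¬ (3 : ℤ) ∣ u i).erase 0).card := by
    have := Finset.pred_card_le_card_erase (s := Finset.univ.filter fun i => ¬ (3 : ℤ) ∣ u i)
      (a := (0 : Fin 24))
    omega
  obtain ⟨i, hi, j, hj, hij⟩ := Finset.one_lt_card.1 h1
  simp only [Finset.mem_erase, Finset.mem_filter, Finset.mem_univ, true_and] at hi hj
  exact ⟨i, j, hi.1, hj.1, hij, hi.2, hj.2⟩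

/-! ### Monomial automorphisms -/

/-- The signed permutation `u ↦ (s i * u (π i))ᵢ` commutes with the Paley matrix. -/
structure IsPaleyAut (π : Fin 24 → Fin 24) (s : Fin 24 → ℤ) : Prop where
  injective : Function.Injective π
  sign : ∀ i, s i * s i = 1
  comm : ∀ i j, paley (π i) (π j) = s i * s j * paley i j

/-- The action of a signed permutation on vectors. -/
def signedPerm (π : Fin 24 → Fin 24) (s : Fin 24 → ℤ) (u : Fin 24 → ℤ) (i : Fin 24) : ℤ :=
  s i * u (π i)

namespace IsPaleyAut

variable {π ρ : Fin 24 → Fin 24} {s r : Fin 24 → ℤ}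

theorem id : IsPaleyAut id 1 := ⟨Function.injective_id, by simp, by simp⟩

theorem comp (h : IsPaleyAut π s) (h' : IsPaleyAut ρ r) :
    IsPaleyAut (π ∘ ρ) (fun i => s (ρ i) * r i) where
  injective := h.injective.comp h'.injective
  sign i := by linear_combination r i * r i * h.sign (ρ i) + h'.sign i
  comm i j := by
    rw [Function.comp_apply, Function.comp_apply, h.comm, h'.comm]
    ring

theorem comp_one (h : IsPaleyAut π 1) (h' : IsPaleyAut ρ 1) : IsPaleyAut (π ∘ ρ) 1 := by
  have := h.comp h'
  simp only [Pi.one_apply, mul_one] at this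
  exact this

theorem iterate_one (h : IsPaleyAut π 1) (n : ℕ) : IsPaleyAut (π^[n]) 1 := by
  induction n with
  | zero => exact IsPaleyAut.id
  | succ n ih => exact ih.comp_one h

theorem bijective (h : IsPaleyAut π s) : Function.Bijective π :=
  Finite.injective_iff_bijective.1 h.injective

theorem sign_eq (h : IsPaleyAut π s) (i : Fin 24) : s i = 1 ∨ s i = -1 :=
  mul_self_eq_one_iff.1 (h.sign i)

theorem signedPerm_vecMul (h : IsPaleyAut π s) (u : Fin 24 → ℤ) :
    signedPerm π s u ᵥ* paleyMatrix = signedPerm π s (u ᵥ* paleyMatrix) := by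
  ext j
  simp only [signedPerm, Matrix.vecMul, dotProduct, paleyMatrix, Matrix.of_apply]
  rw [← h.bijective.sum_comp fun k => u k * paley k (π j), Finset.mul_sum]
  refine Finset.sum_congr rfl fun i _ => ?_
  rw [h.comm]
  linear_combination -(s i * u (π i) * paley i j) * h.sign j

theorem isCodeword (h : IsPaleyAut π s) {u v : Fin 24 → ℤ} (huv : IsCodeword u v) :
    IsCodeword (signedPerm π s u) (signedPerm π s v) := by
  intro j
  rw [h.signedPerm_vecMul, signedPerm, signedPerm, ← mul_sub]
  exact (huv (π j)).mul_left _

theorem dvd_signedPerm (h : IsPaleyAut π s) {u : Fin 24 → ℤ} {i : Fin 24} :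
    (3 : ℤ) ∣ signedPerm π s u i ↔ (3 : ℤ) ∣ u (π i) := by
  rcases h.sign_eq i with hs | hs <;> simp [signedPerm, hs]

theorem ternaryWeight_signedPerm (h : IsPaleyAut π s) (u : Fin 24 → ℤ) :
    ternaryWeight (signedPerm π s u) = ternaryWeight u := by
  simp only [ternaryWeight, h.dvd_signedPerm]
  exact h.bijective.sum_comp fun i => if (3 : ℤ) ∣ u i then 0 else 1

end IsPaleyAut

/-- The translation `x ↦ x + 1` of the projective line. -/
def paleyShift (i : Fin 24) : Fin 24 := if i = 0 then 0 else Fin.ofNat 24 (i.val % 23 + 1)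

/-- The multiplication `x ↦ 2 * x` on the projective line. -/
def paleyDouble (i : Fin 24) : Fin 24 :=
  if i = 0 then 0 else Fin.ofNat 24 (2 * (i.val - 1) % 23 + 1)

/-- The involution `x ↦ -x⁻¹` of the projective line. -/
def paleyInv : Fin 24 → Fin 24 :=
  ![1, 0, 23, 12, 16, 18, 10, 20, 14, 21, 6, 17, 3, 22, 8, 19, 4, 11, 5, 15, 7, 9, 13, 2]

/-- The signs that make `paleyInv` an automorphism. -/
def paleyInvSign : Fin 24 → ℤ :=
  ![1, -1, -1, -1, -1, -1, 1, -1, 1, -1, -1, 1, 1, -1, -1, 1, 1, -1, 1, -1, 1, 1, 1, 1]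

theorem isPaleyAut_paleyShift : IsPaleyAut paleyShift 1 :=
  ⟨by decide +kernel, by decide +kernel, by decide +kernel⟩

theorem isPaleyAut_paleyDouble : IsPaleyAut paleyDouble 1 :=
  ⟨by decide +kernel, by decide +kernel, by decide +kernel⟩

theorem isPaleyAut_paleyInv : IsPaleyAut paleyInv paleyInvSign :=
  ⟨by decide +kernel, by decide +kernel, by decide +kernel⟩

theorem exists_isPaleyAut_apply_zero (j : Fin 24) : ∃ π s, IsPaleyAut π s ∧ π 0 = j := by
  by_cases hj : j = 0
  · exact ⟨id, 1, IsPaleyAut.id, hj.symm⟩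
  · refine ⟨_, _, (isPaleyAut_paleyShift.iterate_one (j.val - 1)).comp isPaleyAut_paleyInv, ?_⟩
    have h : ∀ j : Fin 24, j ≠ 0 → (paleyShift^[j.val - 1] ∘ paleyInv) 0 = j := by decide +kernel
    exact h j hj

/-- The affine automorphisms act transitively on pairs of finite points, because `-1` is not a
square modulo `23`. -/
theorem exists_isPaleyAut_apply_pair {i j : Fin 24} (hi : i ≠ 0) (hj : j ≠ 0) (hij : i ≠ j) :
    ∃ π, IsPaleyAut π 1 ∧ π 0 = 0 ∧ (π 1 = i ∧ π 2 = j ∨ π 1 = j ∧ π 2 = i) := by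
  have h : ∀ i j : Fin 24, i ≠ 0 → j ≠ 0 → i ≠ j → ∃ k : Fin 11,
      (paleyShift^[i.val - 1] ∘ paleyDouble^[k]) 1 = i ∧
        (paleyShift^[i.val - 1] ∘ paleyDouble^[k]) 2 = j ∨
      (paleyShift^[j.val - 1] ∘ paleyDouble^[k]) 1 = j ∧
        (paleyShift^[j.val - 1] ∘ paleyDouble^[k]) 2 = i := by decide +kernel
  have hzero (m n : ℕ) : (paleyShift^[m] ∘ paleyDouble^[n]) 0 = 0 := by
    rw [Function.comp_apply, Function.iterate_fixed (f := paleyDouble) (x := 0) rfl,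
      Function.iterate_fixed (f := paleyShift) (x := 0) rfl]
  have haut (m n : ℕ) : IsPaleyAut (paleyShift^[m] ∘ paleyDouble^[n]) 1 :=
    (isPaleyAut_paleyShift.iterate_one m).comp_one (isPaleyAut_paleyDouble.iterate_one n)
  obtain ⟨k, hk | hk⟩ := h i j hi hj hij
  · exact ⟨_, haut _ _, hzero _ _, Or.inl hk⟩
  · exact ⟨_, haut _ _, hzero _ _, Or.inr hk⟩

/-! ### Exhaustive search over words of small weight

A vector over `𝔽₃` is stored as a pair of bit masks, marking the coordinates equal to `1` and to
`2`. The recursors are applied by hand so that the kernel evaluates the search efficiently. -/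

/-- Evaluates `n` to a numeral before passing it to `f`. -/
noncomputable def force {α : Type} (n : ℕ) (f : ℕ → α) : α :=
  Nat.rec (f 0) (fun k _ => f (Nat.succ k)) n

theorem force_eq {α : Type} (n : ℕ) (f : ℕ → α) : force n f = f n := by
  cases n <;> rfl

/-- Clears the lowest set bit of a number `k` times and tests whether the result is nonzero. -/
noncomputable def moreBitsThan (k : ℕ) : ℕ → Bool :=
  Nat.rec (fun n => Nat.ble 1 n)
    (fun _ ih n => force n fun n => ih (Nat.land n (Nat.pred n))) k

/-- Passes the sum of the vectors with masks `(p, m)` and `(a, b)` to `f`. -/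
noncomputable def addMask (p m a b : ℕ) (f : ℕ → ℕ → Bool) : Bool :=
  force (Nat.xor (Nat.lor p b) (Nat.lor m a)) fun t =>
  force (Nat.xor (Nat.lor m b) t) fun q =>
  force (Nat.xor (Nat.lor p a) t) fun n => f q n

/-- Adds the vector with masks `r` or its negative to `(p, m)`, depending on `b`. -/
noncomputable def addSigned (b : Bool) (p m : ℕ) (r : ℕ × ℕ) (f : ℕ → ℕ → Bool) : Bool :=
  cond b (addMask p m r.1 r.2 f) (addMask p m r.2 r.1 f)

/-- Adds to `(p, m)` all combinations of at most `d` vectors of the list `l`, with coefficients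
`±1` if `sg` holds and `1` otherwise, and tests `leaf` on the results. -/
noncomputable def search (leaf : ℕ → ℕ → ℕ → Bool) (sg : Bool) (l : List (ℕ × ℕ)) :
    ℕ → ℕ → ℕ → Bool :=
  List.rec leaf
    (fun r _ ih d p m =>
      Nat.rec (leaf 0 p m)
        (fun e _ => and (ih (Nat.succ e) p m) (and (addMask p m r.1 r.2 (ih e))
          (or (not sg) (addMask p m r.2 r.1 (ih e))))) d) l

/-- `(p, m)` are the masks of the reduction of `z` modulo `3`. -/
def Encodes (p m : ℕ) (z : Fin 24 → ℤ) : Prop :=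
  p < 2 ^ 24 ∧ m < 2 ^ 24 ∧
    ∀ j : Fin 24, p.testBit j = decide (z j % 3 = 1) ∧ m.testBit j = decide (z j % 3 = 2)

namespace Encodes

variable {p m a b : ℕ} {z w : Fin 24 → ℤ}

theorem zero : Encodes 0 0 0 := ⟨by norm_num, by norm_num, by simp⟩

theorem congr (h : Encodes p m z) (hzw : ∀ j, (3 : ℤ) ∣ w j - z j) : Encodes p m w := by
  refine ⟨h.1, h.2.1, fun j => ?_⟩
  have : w j % 3 = z j % 3 := (Int.emod_emod_of_dvd _ dvd_rfl).symm.trans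
    (by have := hzw j; omega)
  rw [this]
  exact h.2.2 j

theorem neg (h : Encodes p m z) : Encodes m p (-z) := by
  refine ⟨h.2.1, h.1, fun j => ?_⟩
  rw [(h.2.2 j).1, (h.2.2 j).2, Pi.neg_apply]
  constructor <;> rw [decide_eq_decide] <;> omega

theorem add (h : Encodes p m z) (h' : Encodes a b w) :
    Encodes ((m ||| b) ^^^ ((p ||| b) ^^^ (m ||| a))) ((p ||| a) ^^^ ((p ||| b) ^^^ (m ||| a)))
      (z + w) := by
  obtain ⟨hp, hm, hz⟩ := h
  obtain ⟨ha, hb, hw⟩ := h'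
  refine ⟨?_, ?_, fun j => ?_⟩
  · exact Nat.xor_lt_two_pow (Nat.or_lt_two_pow hm hb)
      (Nat.xor_lt_two_pow (Nat.or_lt_two_pow hp hb) (Nat.or_lt_two_pow hm ha))
  · exact Nat.xor_lt_two_pow (Nat.or_lt_two_pow hp ha)
      (Nat.xor_lt_two_pow (Nat.or_lt_two_pow hp hb) (Nat.or_lt_two_pow hm ha))
  · simp only [Nat.testBit_xor, Nat.testBit_or, (hz j).1, (hz j).2, (hw j).1, (hw j).2,
      Pi.add_apply, Int.add_emod (z j)]
    have h1 : z j % 3 = 0 ∨ z j % 3 = 1 ∨ z j % 3 = 2 := by omega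
    have h2 : w j % 3 = 0 ∨ w j % 3 = 1 ∨ w j % 3 = 2 := by omega
    rcases h1 with h1 | h1 | h1 <;> rcases h2 with h2 | h2 | h2 <;> rw [h1, h2] <;> decide

theorem testBit_lor (h : Encodes p m z) (j : Fin 24) :
    (p ||| m).testBit j = decide (¬ (3 : ℤ) ∣ z j) := by
  rw [Nat.testBit_or, (h.2.2 j).1, (h.2.2 j).2, ← Bool.decide_or, decide_eq_decide]
  omega

theorem exists_of_addMask {f : ℕ → ℕ → Bool} (h : Encodes p m z) (h' : Encodes a b w)
    (hf : addMask p m a b f = true) : ∃ p' m', Encodes p' m' (z + w) ∧ f p' m' = true := by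
  simp only [addMask, force_eq] at hf
  exact ⟨_, _, h.add h', hf⟩

end Encodes

theorem lt_sum_testBit_of_moreBitsThan {k n : ℕ} (hn : n < 2 ^ 24)
    (h : moreBitsThan k n = true) :
    k < ∑ j : Fin 24, if n.testBit j = true then 1 else 0 := by
  rw [← Finset.card_filter]
  induction k generalizing n with
  | zero =>
    have h0 : n ≠ 0 := by
      rintro rfl
      exact absurd h (by decide)
    obtain ⟨i, hi⟩ := Nat.exists_testBit_of_ne_zero h0
    have hi24 : i < 24 := by
      by_contra hlt
      rw [Nat.testBit_lt_two_pow (hn.trans_le (Nat.pow_le_pow_right two_pos (not_lt.1 hlt)))] at hi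
      exact absurd hi (by decide)
    exact Finset.card_pos.2 ⟨⟨i, hi24⟩, by simpa using hi⟩
  | succ k ih =>
    have h' : moreBitsThan k (n &&& n.pred) = true := by
      change force n (fun n => moreBitsThan k (n &&& n.pred)) = true at h
      rwa [force_eq] at h
    have hlt := ih ((Nat.and_le_left).trans_lt hn) h'
    refine lt_of_le_of_lt (Nat.succ_le_of_lt hlt) (Finset.card_lt_card ?_)
    refine ⟨fun j => by simpa using fun h1 _ => h1, fun hsub => ?_⟩
    have heq : n &&& n.pred = n := by
      refine Nat.eq_of_testBit_eq fun i => ?_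
      by_cases hi : i < 24
      · have := @hsub ⟨i, hi⟩
        simp only [Finset.mem_filter, Finset.mem_univ, true_and, Nat.testBit_and,
          Bool.and_eq_true] at this
        rw [Nat.testBit_and]
        cases hni : n.testBit i
        · rfl
        · simpa [hni] using this hni
      · have hni : n < 2 ^ i := hn.trans_le (Nat.pow_le_pow_right two_pos (not_lt.1 hi))
        rw [Nat.testBit_and, Nat.testBit_lt_two_pow hni, Bool.false_and]
    have hpos : n ≠ 0 := by
      rintro rfl
      simp at hlt h'
    have : n ≤ n.pred := by
      conv_lhs => rw [← heq]
      exact Nat.and_le_right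
    have := Nat.pred_lt hpos
    omega

theorem Encodes.lt_ternaryWeight {p m k : ℕ} {z : Fin 24 → ℤ} (h : Encodes p m z)
    (hk : moreBitsThan k (Nat.lor p m) = true) : k < ternaryWeight z := by
  refine (lt_sum_testBit_of_moreBitsThan (Nat.or_lt_two_pow h.1 h.2.1) hk).trans_eq ?_
  refine Finset.sum_congr rfl fun j _ => ?_
  have := h.testBit_lor j
  change (if (p ||| m).testBit j = true then 1 else 0) = _
  rw [this]
  by_cases hj : (3 : ℤ) ∣ z j <;> simp [hj]

/-- The masks of the rows of the Paley matrix. -/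
def paleyMasks : List (ℕ × ℕ) :=
  [(16777214, 0), (681660, 16095553), (1363320, 15413891), (2726640, 14050567),
    (5453280, 11323919), (10906560, 5870623), (5035906, 11741245), (10071812, 6705275),
    (3366410, 13410549), (6732820, 10043883), (13465640, 3310551), (10154066, 6621101),
    (3530918, 13242201), (7061836, 9707187), (14123672, 2637159), (11470130, 5274317),
    (6163046, 10548633), (12326092, 4320051), (7874970, 8640101), (15749940, 502987),
    (14722666, 1005973), (12668118, 2011945), (8559022, 4023889), (340830, 8047777)]

/-- The masks of the row `i` of the Paley matrix. -/
def paleyMask (i : Fin 24) : ℕ × ℕ := paleyMasks.getD i (0, 0)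

theorem encodes_paleyMask (i : Fin 24) : Encodes (paleyMask i).1 (paleyMask i).2 (paley i) := by
  have h : ∀ i : Fin 24, (paleyMask i).1 < 2 ^ 24 ∧ (paleyMask i).2 < 2 ^ 24 ∧
      ∀ j : Fin 24, (paleyMask i).1.testBit j = decide (paley i j % 3 = 1) ∧
        (paleyMask i).2.testBit j = decide (paley i j % 3 = 2) := by decide +kernel
  exact h i

/-- The number of indices in a list at which `u` is nonzero modulo `3`. -/
def listWeight (u : Fin 24 → ℤ) (l : List (Fin 24)) : ℕ :=
  (l.map fun i => if (3 : ℤ) ∣ u i then 0 else 1).sum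

/-- The combination of the rows of the Paley matrix in a list with coefficients `u`. -/
def listComb (u : Fin 24 → ℤ) (l : List (Fin 24)) (j : Fin 24) : ℤ :=
  (l.map fun i => u i * paley i j).sum

theorem listComb_cons (u : Fin 24 → ℤ) (i : Fin 24) (l : List (Fin 24)) :
    listComb u (i :: l) = u i • paley i + listComb u l := by
  ext j
  simp [listComb]

theorem listWeight_cons (u : Fin 24 → ℤ) (i : Fin 24) (l : List (Fin 24)) :
    listWeight u (i :: l) = (if (3 : ℤ) ∣ u i then 0 else 1) + listWeight u l := by
  simp [listWeight]

theorem Encodes.add_smul {p m : ℕ} {r : ℕ × ℕ} {z w : Fin 24 → ℤ} {c : ℤ} (h : Encodes p m z)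
    (h' : Encodes r.1 r.2 w) {f : ℕ → ℕ → Bool} (hc : ¬ (3 : ℤ) ∣ c)
    (hf : addSigned (decide (c % 3 = 1)) p m r f = true) :
    ∃ p' m', Encodes p' m' (z + c • w) ∧ f p' m' = true := by
  by_cases h1 : c % 3 = 1
  · rw [decide_eq_true h1] at hf
    obtain ⟨p', m', he, hf'⟩ := h.exists_of_addMask h' hf
    refine ⟨p', m', he.congr fun j => ?_, hf'⟩
    obtain ⟨q, hq⟩ : (3 : ℤ) ∣ c - 1 := by omega
    exact ⟨q * w j, by
      simp only [Pi.add_apply, Pi.smul_apply, smul_eq_mul]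
      linear_combination w j * hq⟩
  · rw [decide_eq_false h1] at hf
    obtain ⟨p', m', he, hf'⟩ := h.exists_of_addMask h'.neg hf
    refine ⟨p', m', he.congr fun j => ?_, hf'⟩
    obtain ⟨q, hq⟩ : (3 : ℤ) ∣ c + 1 := by omega
    exact ⟨q * w j, by
      simp only [Pi.add_apply, Pi.smul_apply, Pi.neg_apply, smul_eq_mul]
      linear_combination w j * hq⟩

theorem search_zero (leaf : ℕ → ℕ → ℕ → Bool) (sg : Bool) (l : List (ℕ × ℕ)) (p m : ℕ) :
    search leaf sg l 0 p m = leaf 0 p m := by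
  cases l <;> rfl

theorem search_cons_succ (leaf : ℕ → ℕ → ℕ → Bool) (sg : Bool) (r : ℕ × ℕ) (l : List (ℕ × ℕ))
    (d p m : ℕ) : search leaf sg (r :: l) (d + 1) p m =
      (search leaf sg l (d + 1) p m && (addMask p m r.1 r.2 (search leaf sg l d) &&
        (!sg || addMask p m r.2 r.1 (search leaf sg l d)))) := rfl

theorem of_search {leaf : ℕ → ℕ → ℕ → Bool} {sg : Bool} {Q : ℕ → (Fin 24 → ℤ) → Prop}
    (hleaf : ∀ d p m z, Encodes p m z → leaf d p m = true → Q d z) {u : Fin 24 → ℤ}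
    (hu : sg = true ∨ ∀ i, u i % 3 ≠ 2) (l : List (Fin 24)) {d p m : ℕ} {z : Fin 24 → ℤ}
    (hz : Encodes p m z) (hs : search leaf sg (l.map paleyMask) d p m = true)
    (hd : listWeight u l ≤ d) : Q (d - listWeight u l) (z + listComb u l) := by
  induction l generalizing d p m z with
  | nil =>
    have : z + listComb u [] = z := by
      ext j
      simp [listComb]
    rw [this]
    exact hleaf _ _ _ _ hz hs
  | cons i l ih =>
    rw [listWeight_cons] at hd ⊢
    rw [listComb_cons, ← add_assoc]
    by_cases hi : (3 : ℤ) ∣ u i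
    · rw [if_pos hi, zero_add] at hd ⊢
      have hz' : Encodes p m (z + u i • paley i) := hz.congr fun j => by
        simpa using hi.mul_right (paley i j)
      refine ih hz' ?_ hd
      cases d with
      | zero => rwa [search_zero] at hs ⊢
      | succ d =>
        rw [List.map_cons, search_cons_succ, Bool.and_eq_true] at hs
        exact hs.1
    · rw [if_neg hi] at hd ⊢
      obtain ⟨d, rfl⟩ : ∃ d', d = d' + 1 := ⟨d - 1, by omega⟩
      rw [List.map_cons, search_cons_succ, Bool.and_eq_true, Bool.and_eq_true,
        Bool.or_eq_true] at hs
      have hf : addSigned (decide (u i % 3 = 1)) p m (paleyMask i)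
          (search leaf sg (l.map paleyMask) d) = true := by
        by_cases h1 : u i % 3 = 1
        · rw [decide_eq_true h1]
          exact hs.2.1
        · rw [decide_eq_false h1]
          rcases hs.2.2 with h | h
          · rcases hu with hu | hu
            · simp [hu] at h
            · have := hu i
              omega
          · exact h
      obtain ⟨p', m', he, hs'⟩ := hz.add_smul (encodes_paleyMask i) hi hf
      have := ih he hs' (by omega)
      rwa [show d + 1 - (1 + listWeight u l) = d - listWeight u l by omega]

theorem vecMul_paley_eq_listComb (u : Fin 24 → ℤ) :
    u ᵥ* paleyMatrix = listComb u (List.finRange 24) := by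
  ext j
  simp [Matrix.vecMul, dotProduct, paleyMatrix, listComb, Fin.sum_univ_def]

theorem ternaryWeight_eq_listWeight (u : Fin 24 → ℤ) :
    ternaryWeight u = listWeight u (List.finRange 24) := by
  simp [ternaryWeight, listWeight, Fin.sum_univ_def]

theorem ternaryWeight_neg (u : Fin 24 → ℤ) : ternaryWeight (-u) = ternaryWeight u := by
  simp [ternaryWeight]

/-- Accepts the vectors of weight more than `d + k`. -/
noncomputable def weightLeaf (k d p m : ℕ) : Bool := moreBitsThan (Nat.add d k) (Nat.lor p m)

theorem map_paleyMask_drop (k : ℕ) :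
    ((List.finRange 24).drop k).map paleyMask = paleyMasks.drop k := by
  rw [List.map_drop]
  rfl

theorem search_weight_one :
    search (weightLeaf 10) true (paleyMasks.drop 1) 1 (paleyMask 0).1 (paleyMask 0).2 = true := by
  decide +kernel

theorem search_weight_three : ∀ b c : Bool,
    addSigned b (paleyMask 0).1 (paleyMask 0).2 (paleyMask 1) (fun p m =>
      addSigned c p m (paleyMask 2) (search (weightLeaf 6) true (paleyMasks.drop 3) 3)) = true := by
  decide +kernel

theorem encodes_smul_paley_zero {u : Fin 24 → ℤ} (h0 : u 0 % 3 = 1) :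
    Encodes (paleyMask 0).1 (paleyMask 0).2 (u 0 • paley 0) := by
  refine (encodes_paleyMask 0).congr fun j => ?_
  obtain ⟨q, hq⟩ : (3 : ℤ) ∣ u 0 - 1 := by omega
  exact ⟨q * paley 0 j, by
    simp only [Pi.smul_apply, smul_eq_mul]
    linear_combination paley 0 j * hq⟩

theorem lt_weight_of_ternaryWeight_le_two {u : Fin 24 → ℤ} (h0 : u 0 % 3 = 1)
    (hu : ternaryWeight u ≤ 2) : 12 < ternaryWeight u + ternaryWeight (u ᵥ* paleyMatrix) := by
  have hl : List.finRange 24 = 0 :: (List.finRange 24).drop 1 := rfl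
  have hw := ternaryWeight_eq_listWeight u
  rw [hl, listWeight_cons, if_neg (by omega)] at hw
  have hs := search_weight_one
  rw [← map_paleyMask_drop] at hs
  have := of_search (Q := fun d z => d + 10 < ternaryWeight z)
    (fun d p m z hz h => hz.lt_ternaryWeight h) (u := u) (Or.inl rfl)
    ((List.finRange 24).drop 1) (encodes_smul_paley_zero h0) hs (by omega)
  rw [← listComb_cons, ← hl, ← vecMul_paley_eq_listComb] at this
  omega

theorem lt_weight_of_apply_one_two {u : Fin 24 → ℤ} (h0 : u 0 % 3 = 1) (h1 : ¬ (3 : ℤ) ∣ u 1)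
    (h2 : ¬ (3 : ℤ) ∣ u 2) (hu : ternaryWeight u ≤ 6) :
    12 < ternaryWeight u + ternaryWeight (u ᵥ* paleyMatrix) := by
  have hl : List.finRange 24 = 0 :: 1 :: 2 :: (List.finRange 24).drop 3 := rfl
  have hw := ternaryWeight_eq_listWeight u
  rw [hl, listWeight_cons, listWeight_cons, listWeight_cons, if_neg (by omega), if_neg h1,
    if_neg h2] at hw
  obtain ⟨p, m, hz, hs⟩ := (encodes_smul_paley_zero h0).add_smul (encodes_paleyMask 1) h1
    (search_weight_three _ (decide (u 2 % 3 = 1)))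
  obtain ⟨p, m, hz, hs⟩ := hz.add_smul (encodes_paleyMask 2) h2 hs
  rw [← map_paleyMask_drop] at hs
  have := of_search (Q := fun d z => d + 6 < ternaryWeight z)
    (fun d p m z hz h => hz.lt_ternaryWeight h) (u := u)
    (Or.inl rfl) ((List.finRange 24).drop 3) hz hs (by omega)
  rw [add_assoc, add_assoc, ← listComb_cons, ← listComb_cons, ← listComb_cons, ← hl,
    ← vecMul_paley_eq_listComb] at this
  omega

theorem lt_weight_of_apply_zero {u : Fin 24 → ℤ} (h0 : u 0 % 3 = 1) (hu : ternaryWeight u ≤ 6) :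
    12 < ternaryWeight u + ternaryWeight (u ᵥ* paleyMatrix) := by
  by_cases h2 : 2 < ternaryWeight u
  · obtain ⟨i, j, hi, hj, hij, hui, huj⟩ := exists_pair_of_two_lt_ternaryWeight h2
    obtain ⟨π, hπ, hπ0, hπij⟩ := exists_isPaleyAut_apply_pair hi hj hij
    have h0' : signedPerm π 1 u 0 % 3 = 1 := by
      rw [signedPerm, hπ0, Pi.one_apply, one_mul, h0]
    have h1' : ¬ (3 : ℤ) ∣ signedPerm π 1 u 1 := by
      rw [hπ.dvd_signedPerm]
      rcases hπij with h | h <;> rw [h.1] <;> assumption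
    have h2' : ¬ (3 : ℤ) ∣ signedPerm π 1 u 2 := by
      rw [hπ.dvd_signedPerm]
      rcases hπij with h | h <;> rw [h.2] <;> assumption
    rw [← hπ.ternaryWeight_signedPerm] at hu ⊢
    rw [← hπ.ternaryWeight_signedPerm (u ᵥ* paleyMatrix), ← hπ.signedPerm_vecMul]
    exact lt_weight_of_apply_one_two h0' h1' h2' hu
  · exact lt_weight_of_ternaryWeight_le_two h0 (not_lt.1 h2)

theorem lt_weight {u : Fin 24 → ℤ} {i : Fin 24} (hi : ¬ (3 : ℤ) ∣ u i)
    (hu : ternaryWeight u ≤ 6) :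
    12 < ternaryWeight u + ternaryWeight (u ᵥ* paleyMatrix) := by
  obtain ⟨π, s, hπ, rfl⟩ := exists_isPaleyAut_apply_zero i
  rw [← hπ.dvd_signedPerm] at hi
  rw [← hπ.ternaryWeight_signedPerm] at hu ⊢
  rw [← hπ.ternaryWeight_signedPerm (u ᵥ* paleyMatrix), ← hπ.signedPerm_vecMul]
  generalize signedPerm π s u = w at *
  by_cases h0 : w 0 % 3 = 1
  · exact lt_weight_of_apply_zero h0 hu
  · have := @lt_weight_of_apply_zero (-w) (by rw [Pi.neg_apply]; omega)
      (by rwa [ternaryWeight_neg])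
    rwa [Matrix.neg_vecMul, ternaryWeight_neg, ternaryWeight_neg] at this

theorem IsCodeword.dvd_of_dvd_left {u v : Fin 24 → ℤ} (h : IsCodeword u v)
    (hu : ∀ i, (3 : ℤ) ∣ u i) (j : Fin 24) : (3 : ℤ) ∣ v j := by
  have : (3 : ℤ) ∣ (u ᵥ* paleyMatrix) j := by
    rw [Matrix.vecMul, dotProduct]
    exact Finset.dvd_sum fun i _ => (hu i).mul_right _
  exact (dvd_iff_dvd_of_dvd_sub (h j)).2 this

/-- The code has minimum weight at least `13` (in fact `15`). -/
theorem IsCodeword.lt_ternaryWeight {u v : Fin 24 → ℤ} (h : IsCodeword u v)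
    (h0 : ¬ ∀ i, (3 : ℤ) ∣ u i) : 12 < ternaryWeight u + ternaryWeight v := by
  by_contra! hle
  rcases le_or_gt (ternaryWeight u) 6 with hu | hu
  · obtain ⟨i, hi⟩ := not_forall.1 h0
    have := lt_weight hi hu
    rw [← h.ternaryWeight_eq] at this
    omega
  · have hv : ¬ ∀ i, (3 : ℤ) ∣ v i := fun hv => h0 (h.swap.dvd_of_dvd_left hv)
    obtain ⟨i, hi⟩ := not_forall.1 hv
    have := lt_weight hi (by omega)
    rw [← h.swap.ternaryWeight_eq] at this
    omega

/-! ### Codewords with all entries in `{0, 1}` -/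

/-- Accepts the vectors that are zero, have an entry `2`, or have weight more than `15`. -/
noncomputable def binaryLeaf (_d p m : ℕ) : Bool :=
  or (Nat.ble 1 m) (or (moreBitsThan 15 (Nat.lor p m)) (Nat.beq (Nat.lor p m) 0))

theorem Encodes.of_binaryLeaf {d p m : ℕ} {z : Fin 24 → ℤ} (hz : Encodes p m z)
    (h : binaryLeaf d p m = true) :
    (∀ j, (3 : ℤ) ∣ z j) ∨ (∃ j, z j % 3 = 2) ∨ 15 < ternaryWeight z := by
  rw [binaryLeaf, Bool.or_eq_true, Bool.or_eq_true] at h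
  rcases h with h | h | h
  · right; left
    have hm : 1 ≤ m := Nat.le_of_ble_eq_true h
    obtain ⟨i, hi⟩ := Nat.exists_testBit_of_ne_zero (by omega : m ≠ 0)
    have hi24 : i < 24 := by
      by_contra hlt
      rw [Nat.testBit_lt_two_pow
        (hz.2.1.trans_le (Nat.pow_le_pow_right two_pos (not_lt.1 hlt)))] at hi
      exact absurd hi (by decide)
    have := (hz.2.2 ⟨i, hi24⟩).2
    exact ⟨⟨i, hi24⟩, by simpa [hi] using this⟩
  · exact Or.inr (Or.inr (hz.lt_ternaryWeight h))
  · left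
    intro j
    have h0 : p ||| m = 0 := Nat.eq_of_beq_eq_true h
    have := hz.testBit_lor j
    rw [h0] at this
    simpa using this

theorem search_binary_two : search binaryLeaf false (paleyMasks.drop 0) 2 0 0 = true := by
  decide +kernel

theorem search_binary_seven :
    addSigned true (paleyMask 1).1 (paleyMask 1).2 (paleyMask 2)
      (search binaryLeaf false (paleyMask 0 :: paleyMasks.drop 3) 5) = true := by
  decide +kernel

/-- `z` vanishes modulo `3`, has an entry `2` modulo `3`, or has weight more than `15`. -/
def IsTrivialOrExcluded (z : Fin 24 → ℤ) : Prop :=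
  (∀ j, (3 : ℤ) ∣ z j) ∨ (∃ j, z j % 3 = 2) ∨ 15 < ternaryWeight z

theorem isTrivialOrExcluded_of_ternaryWeight_le_two {u : Fin 24 → ℤ} (hu : ∀ i, u i % 3 ≠ 2)
    (hw : ternaryWeight u ≤ 2) : IsTrivialOrExcluded (u ᵥ* paleyMatrix) := by
  have hs := search_binary_two
  rw [← map_paleyMask_drop, List.drop_zero] at hs
  rw [ternaryWeight_eq_listWeight] at hw
  have := of_search (Q := fun _ z => IsTrivialOrExcluded z)
    (fun d p m z hz h => hz.of_binaryLeaf h) (u := u) (Or.inr hu) (List.finRange 24)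
    Encodes.zero hs hw
  rwa [zero_add, ← vecMul_paley_eq_listComb] at this

theorem isTrivialOrExcluded_of_apply_one_two {u : Fin 24 → ℤ} (hu : ∀ i, u i % 3 ≠ 2)
    (h1 : u 1 % 3 = 1) (h2 : u 2 % 3 = 1) (hw : ternaryWeight u ≤ 7) :
    IsTrivialOrExcluded (u ᵥ* paleyMatrix) := by
  have hperm : (List.finRange 24).Perm (1 :: 2 :: 0 :: (List.finRange 24).drop 3) := by decide
  have hcomb : listComb u (List.finRange 24) =
      listComb u (1 :: 2 :: 0 :: (List.finRange 24).drop 3) := by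
    ext j
    exact (hperm.map _).sum_eq
  have hweight : listWeight u (List.finRange 24) =
      listWeight u (1 :: 2 :: 0 :: (List.finRange 24).drop 3) := (hperm.map _).sum_eq
  rw [ternaryWeight_eq_listWeight, hweight, listWeight_cons, listWeight_cons, if_neg (by omega),
    if_neg (by omega)] at hw
  have hz : Encodes (paleyMask 1).1 (paleyMask 1).2 (u 1 • paley 1) := by
    refine (encodes_paleyMask 1).congr fun j => ?_
    obtain ⟨q, hq⟩ : (3 : ℤ) ∣ u 1 - 1 := by omega
    exact ⟨q * paley 1 j, by
      simp only [Pi.smul_apply, smul_eq_mul]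
      linear_combination paley 1 j * hq⟩
  have hs : addSigned (decide (u 2 % 3 = 1)) (paleyMask 1).1 (paleyMask 1).2 (paleyMask 2)
      (search binaryLeaf false (paleyMask 0 :: paleyMasks.drop 3) 5) = true := by
    rw [decide_eq_true h2]
    exact search_binary_seven
  have hu2 : ¬ (3 : ℤ) ∣ u 2 := by omega
  obtain ⟨p, m, hz, hs⟩ := hz.add_smul (encodes_paleyMask 2) hu2 hs
  rw [← map_paleyMask_drop, ← List.map_cons] at hs
  have := of_search (Q := fun _ z => IsTrivialOrExcluded z)
    (fun d p m z hz h => hz.of_binaryLeaf h) (u := u) (Or.inr hu)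
    (0 :: (List.finRange 24).drop 3) (d := 5) hz hs (by omega)
  rwa [add_assoc, ← listComb_cons, ← listComb_cons, ← hcomb, ← vecMul_paley_eq_listComb] at this

theorem isTrivialOrExcluded_of_ternaryWeight_le_seven {u : Fin 24 → ℤ} (hu : ∀ i, u i % 3 ≠ 2)
    (hw : ternaryWeight u ≤ 7) : IsTrivialOrExcluded (u ᵥ* paleyMatrix) := by
  by_cases h2 : 2 < ternaryWeight u
  · obtain ⟨i, j, hi, hj, hij, hui, huj⟩ := exists_pair_of_two_lt_ternaryWeight h2
    obtain ⟨π, hπ, hπ0, hπij⟩ := exists_isPaleyAut_apply_pair hi hj hij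
    have happ (z : Fin 24 → ℤ) (k : Fin 24) : signedPerm π 1 z k = z (π k) := by
      rw [signedPerm, Pi.one_apply, one_mul]
    have hui' : u i % 3 = 1 := by
      have := hu i
      omega
    have huj' : u j % 3 = 1 := by
      have := hu j
      omega
    have h1' : signedPerm π 1 u 1 % 3 = 1 := by
      rw [happ]
      rcases hπij with h | h <;> rw [h.1] <;> assumption
    have h2' : signedPerm π 1 u 2 % 3 = 1 := by
      rw [happ]
      rcases hπij with h | h <;> rw [h.2] <;> assumption
    have hu' (k : Fin 24) : signedPerm π 1 u k % 3 ≠ 2 := by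
      rw [happ]
      exact hu _
    rw [← hπ.ternaryWeight_signedPerm] at hw
    have h := isTrivialOrExcluded_of_apply_one_two hu' h1' h2' hw
    rw [hπ.signedPerm_vecMul] at h
    rcases h with h | ⟨k, hk⟩ | h
    · left
      intro k
      obtain ⟨k, rfl⟩ := hπ.bijective.surjective k
      exact hπ.dvd_signedPerm.1 (h k)
    · exact Or.inr (Or.inl ⟨π k, by rwa [happ] at hk⟩)
    · exact Or.inr (Or.inr (by rwa [hπ.ternaryWeight_signedPerm] at h))
  · exact isTrivialOrExcluded_of_ternaryWeight_le_two hu (not_lt.1 h2)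

theorem ternaryWeight_eq_sum {u : Fin 24 → ℤ} (hu : ∀ i, u i = 0 ∨ u i = 1) :
    (ternaryWeight u : ℤ) = ∑ i, u i := by
  rw [ternaryWeight, Nat.cast_sum]
  exact Finset.sum_congr rfl fun i _ => by rcases hu i with h | h <;> simp [h]

theorem IsCodeword.eq_zero_of_ternaryWeight_le_seven {u v : Fin 24 → ℤ} (h : IsCodeword u v)
    (hu : ∀ i, u i = 0 ∨ u i = 1) (hv : ∀ i, v i = 0 ∨ v i = 1) (hw : ternaryWeight u ≤ 7)
    (hw' : ternaryWeight v ≤ 15) : u = 0 ∧ v = 0 := by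
  have key := isTrivialOrExcluded_of_ternaryWeight_le_seven (u := u)
    (fun i => by rcases hu i with h | h <;> simp [h]) hw
  rw [IsTrivialOrExcluded, ← h.ternaryWeight_eq] at key
  have hv3 : ∀ j, (3 : ℤ) ∣ v j := by
    rcases key with hz | ⟨j, hj⟩ | hz
    · exact fun j => (dvd_iff_dvd_of_dvd_sub (h j)).2 (hz j)
    · have := h j
      rcases hv j with h0 | h0 <;> omega
    · omega
  have hu3 := h.swap.dvd_of_dvd_left hv3
  constructor <;> ext i
  · have := hu3 i
    rcases hu i with h0 | h0 <;> simp_all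
  · have := hv3 i
    rcases hv i with h0 | h0 <;> simp_all

/-- No nonzero codeword of weight at most `15` has all its entries in `{0, 1}`. -/
theorem IsCodeword.eq_zero_of_sum_le {u v : Fin 24 → ℤ} (h : IsCodeword u v)
    (hu : ∀ i, u i = 0 ∨ u i = 1) (hv : ∀ i, v i = 0 ∨ v i = 1)
    (hw : ∑ i, u i + ∑ i, v i ≤ 15) : u = 0 ∧ v = 0 := by
  rw [← ternaryWeight_eq_sum hu, ← ternaryWeight_eq_sum hv] at hw
  rcases le_or_gt (ternaryWeight u) 7 with h7 | h7
  · exact h.eq_zero_of_ternaryWeight_le_seven hu hv h7 (by omega)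
  · exact (h.swap.eq_zero_of_ternaryWeight_le_seven hv hu (by omega) (by omega)).symm

/-! ### Codewords with all entries `±1` -/

theorem isCodeword_one : IsCodeword 1 1 := by
  have h : ∀ j, (3 : ℤ) ∣ 1 - ∑ i, paley i j := by decide +kernel
  intro j
  simpa [Matrix.vecMul, dotProduct, paleyMatrix] using h j

/-- The inner product of `(u, v)` with the `j`-th column of `(1 - S, 1 - S)`. -/
def correlation (u v : Fin 24 → ℤ) (j : Fin 24) : ℤ :=
  (u + v) j - ((u + v) ᵥ* paleyMatrix) j

theorem correlation_zero (u v : Fin 24 → ℤ) :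
    correlation u v 0 = ∑ i, u i + ∑ i, v i := by
  have h : ∀ i : Fin 24, i ≠ 0 → paley i 0 = -1 := by decide +kernel
  rw [correlation, Matrix.vecMul, dotProduct, ← Finset.sum_add_distrib,
    ← Finset.add_sum_erase _ _ (Finset.mem_univ 0),
    ← Finset.add_sum_erase _ (fun i => u i + v i) (Finset.mem_univ 0)]
  have h0 : paleyMatrix 0 0 = 0 := by decide +kernel
  rw [h0, mul_zero, zero_add, sub_eq_add_neg, ← Finset.sum_neg_distrib, Pi.add_apply]
  congr 1
  refine Finset.sum_congr rfl fun i hi => ?_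
  rw [show paleyMatrix i 0 = -1 from h i (Finset.ne_of_mem_erase hi), Pi.add_apply]
  ring

theorem correlation_neg (u v : Fin 24 → ℤ) (j : Fin 24) :
    correlation (-u) (-v) j = -correlation u v j := by
  rw [correlation, correlation, ← neg_add, Matrix.neg_vecMul, Pi.neg_apply, Pi.neg_apply]
  ring

theorem signedPerm_add (π : Fin 24 → Fin 24) (s u v : Fin 24 → ℤ) :
    signedPerm π s (u + v) = signedPerm π s u + signedPerm π s v := by
  ext i
  simp only [signedPerm, Pi.add_apply, mul_add]

theorem IsPaleyAut.correlation_signedPerm {π : Fin 24 → Fin 24} {s : Fin 24 → ℤ}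
    (h : IsPaleyAut π s) (u v : Fin 24 → ℤ) (j : Fin 24) :
    correlation (signedPerm π s u) (signedPerm π s v) j = s j * correlation u v (π j) := by
  rw [correlation, ← signedPerm_add, h.signedPerm_vecMul, signedPerm, signedPerm, correlation]
  ring

theorem IsPaleyAut.signedPerm_eq {π : Fin 24 → Fin 24} {s u : Fin 24 → ℤ}
    (h : IsPaleyAut π s) (hu : ∀ i, u i = 1 ∨ u i = -1) (i : Fin 24) :
    signedPerm π s u i = 1 ∨ signedPerm π s u i = -1 := by
  rw [signedPerm]
  rcases h.sign_eq i with h | h <;> rcases hu (π i) with h' | h' <;> simp [h, h']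

theorem neg_eq_one_or_neg_one {u : Fin 24 → ℤ} (hu : ∀ i, u i = 1 ∨ u i = -1) (i : Fin 24) :
    (-u) i = 1 ∨ (-u) i = -1 := by
  rw [Pi.neg_apply]
  have := hu i
  omega

theorem IsCodeword.correlation_zero_eq {u v : Fin 24 → ℤ} (h : IsCodeword u v)
    (hu : ∀ i, u i = 1 ∨ u i = -1) (hv : ∀ i, v i = 1 ∨ v i = -1)
    (hc : 18 ≤ correlation u v 0) : correlation u v 0 = 48 := by
  have hsum (u : Fin 24 → ℤ) : 2 * ∑ i, (1 - u i) / 2 = ∑ i, 2 * ((1 - u i) / 2) :=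
    Finset.mul_sum ..
  have hhalf {u : Fin 24 → ℤ} (hu : ∀ i, u i = 1 ∨ u i = -1) (i : Fin 24) :
      2 * ((1 - u i) / 2) = 1 - u i := by
    rcases hu i with h | h <;> simp [h]
  have hsum' {u : Fin 24 → ℤ} (hu : ∀ i, u i = 1 ∨ u i = -1) :
      2 * ∑ i, (1 - u i) / 2 = 24 - ∑ i, u i := by
    rw [hsum, Finset.sum_congr rfl fun i _ => hhalf hu i, Finset.sum_sub_distrib]
    simp
  have hbin {u : Fin 24 → ℤ} (hu : ∀ i, u i = 1 ∨ u i = -1) (i : Fin 24) :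
      (1 - u i) / 2 = 0 ∨ (1 - u i) / 2 = 1 := by
    rcases hu i with h | h <;> simp [h]
  have hext {u : Fin 24 → ℤ} (hu : ∀ i, u i = 1 ∨ u i = -1) :
      1 + -u = (2 : ℤ) • fun i => (1 - u i) / 2 := by
    ext i
    rw [Pi.smul_apply, smul_eq_mul, hhalf hu i, Pi.add_apply, Pi.one_apply, Pi.neg_apply]
    ring
  have hcode := isCodeword_one.add h.neg
  rw [hext hu, hext hv] at hcode
  have hcode := hcode.of_smul (by norm_num)
  rw [correlation_zero] at hc ⊢
  have h1 := hsum' hu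
  have h2 := hsum' hv
  obtain ⟨ha, hb⟩ := hcode.eq_zero_of_sum_le (hbin hu) (hbin hv) (by linarith)
  simp only [funext_iff, Pi.zero_apply] at ha hb
  simp only [ha, hb, Finset.sum_const_zero, mul_zero] at h1 h2
  linarith

theorem IsCodeword.abs_correlation_eq {u v : Fin 24 → ℤ} (h : IsCodeword u v)
    (hu : ∀ i, u i = 1 ∨ u i = -1) (hv : ∀ i, v i = 1 ∨ v i = -1) (j : Fin 24)
    (hc : 18 ≤ |correlation u v j|) : |correlation u v j| = 48 := by
  obtain ⟨π, s, hπ, rfl⟩ := exists_isPaleyAut_apply_zero j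
  have habs : |correlation u v (π 0)| =
      |correlation (signedPerm π s u) (signedPerm π s v) 0| := by
    rw [hπ.correlation_signedPerm, abs_mul]
    rcases hπ.sign_eq 0 with h | h <;> simp [h]
  rw [habs] at hc ⊢
  have hcode := hπ.isCodeword h
  have hu' := hπ.signedPerm_eq hu
  have hv' := hπ.signedPerm_eq hv
  rcases le_abs.1 hc with hc | hc
  · rw [hcode.correlation_zero_eq hu' hv' hc]
    rfl
  · rw [← correlation_neg] at hc
    rw [← abs_neg, ← correlation_neg, hcode.neg.correlation_zero_eq (neg_eq_one_or_neg_one hu')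
      (neg_eq_one_or_neg_one hv') hc]
    rfl

/-- The reflection `x ↦ -x` of the projective line. -/
def paleyReflect (i : Fin 24) : Fin 24 := if i.val ≤ 1 then i else Fin.ofNat 24 (25 - i.val)

/-- The signs that make `paleyReflect` an anti-automorphism. -/
def paleyReflectSign (i : Fin 24) : ℤ := if i = 0 then -1 else 1

theorem signedPerm_paleyReflect_vecMul (u : Fin 24 → ℤ) :
    signedPerm paleyReflect paleyReflectSign u ᵥ* paleyMatrix =
      -signedPerm paleyReflect paleyReflectSign (u ᵥ* paleyMatrix) := by
  have hinj : Function.Injective paleyReflect := by decide +kernel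
  have hcomm : ∀ i j, paley (paleyReflect i) (paleyReflect j) =
      -(paleyReflectSign i * paleyReflectSign j * paley i j) := by decide +kernel
  have hsign : ∀ j, paleyReflectSign j * paleyReflectSign j = 1 := by decide +kernel
  ext j
  rw [Pi.neg_apply]
  simp only [signedPerm, Matrix.vecMul, dotProduct, paleyMatrix, Matrix.of_apply]
  rw [← (Finite.injective_iff_bijective.1 hinj).sum_comp fun k => u k * paley k (paleyReflect j),
    Finset.mul_sum, ← Finset.sum_neg_distrib]
  refine Finset.sum_congr rfl fun i _ => ?_
  rw [hcomm]
  linear_combination -(paleyReflectSign i * u (paleyReflect i) * paley i j) * hsign j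

theorem IsCodeword.reflect {u v : Fin 24 → ℤ} (h : IsCodeword u v) :
    IsCodeword (signedPerm paleyReflect paleyReflectSign u)
      (-signedPerm paleyReflect paleyReflectSign v) := by
  intro j
  rw [signedPerm_paleyReflect_vecMul, Pi.neg_apply, Pi.neg_apply, signedPerm, signedPerm]
  rw [show -(paleyReflectSign j * v (paleyReflect j)) -
      -(paleyReflectSign j * (u ᵥ* paleyMatrix) (paleyReflect j)) =
      -paleyReflectSign j * (v (paleyReflect j) - (u ᵥ* paleyMatrix) (paleyReflect j)) by ring]
  exact (h (paleyReflect j)).mul_left _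

theorem dvd_vecMul_paley_sub_sum {y : Fin 24 → ℤ} (hy : ∀ i, (2 : ℤ) ∣ y i) (j : Fin 24) :
    (4 : ℤ) ∣ (y ᵥ* paleyMatrix) j - ∑ i, y i + y j := by
  have h : ∀ i j : Fin 24, (2 : ℤ) ∣ paley i j - 1 + if i = j then 1 else 0 := by
    decide +kernel
  have hsum : (y ᵥ* paleyMatrix) j - ∑ i, y i + y j =
      ∑ i, y i * (paley i j - 1 + if i = j then 1 else 0) := by
    simp [mul_add, mul_sub, Finset.sum_add_distrib, Matrix.vecMul, dotProduct, paleyMatrix]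
  rw [hsum]
  exact Finset.dvd_sum fun i _ => mul_dvd_mul (hy i) (h i j)

theorem IsCodeword.correlation_emod {u v : Fin 24 → ℤ} (h : IsCodeword u v)
    (hu : ∀ i, u i = 1 ∨ u i = -1) (hv : ∀ i, v i = 1 ∨ v i = -1)
    (hsum : (∑ i, u i + ∑ i, v i) % 4 = 2) (j : Fin 24) : correlation u v j % 12 = 6 := by
  have h3 := h j
  have h3' := h.swap j
  have h2 (i : Fin 24) : (2 : ℤ) ∣ (u + v) i := by
    rw [Pi.add_apply]
    rcases hu i with h | h <;> rcases hv i with h' | h' <;> simp [h, h']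
  have h4 := dvd_vecMul_paley_sub_sum h2 j
  have h2' := h2 j
  simp only [Pi.add_apply, Finset.sum_add_distrib] at h4 h2'
  rw [correlation]
  rw [Matrix.add_vecMul] at h4 ⊢
  simp only [Pi.add_apply] at h4 h2' ⊢
  omega

theorem sum_correlation_sq (y : Fin 24 → ℤ) :
    ∑ j, (y j - (y ᵥ* paleyMatrix) j) ^ 2 = 24 * (y ⬝ᵥ y) := by
  have h1 := vecMul_paley_dotProduct y y
  have h2 := vecMul_paley_dotProduct_vecMul_paley y y
  rw [dotProduct_comm] at h1
  have : ∑ j, (y j - (y ᵥ* paleyMatrix) j) ^ 2 = y ⬝ᵥ y - 2 * (y ⬝ᵥ (y ᵥ* paleyMatrix)) +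
      (y ᵥ* paleyMatrix) ⬝ᵥ (y ᵥ* paleyMatrix) := by
    simp only [dotProduct, Finset.mul_sum, ← Finset.sum_sub_distrib, ← Finset.sum_add_distrib]
    exact Finset.sum_congr rfl fun _ _ => by ring
  rw [this]
  linarith

theorem IsCodeword.sum_emod_ne {u v : Fin 24 → ℤ} (h : IsCodeword u v)
    (hu : ∀ i, u i = 1 ∨ u i = -1) (hv : ∀ i, v i = 1 ∨ v i = -1) :
    (∑ i, u i + ∑ i, v i) % 4 ≠ 2 := by
  intro hsum
  have haux {u v : Fin 24 → ℤ} (h : IsCodeword u v)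
      (hu : ∀ i, u i = 1 ∨ u i = -1) (hv : ∀ i, v i = 1 ∨ v i = -1)
      (hsum : (∑ i, u i + ∑ i, v i) % 4 = 2) (j : Fin 24) : correlation u v j ^ 2 = 36 := by
    have h6 := h.correlation_emod hu hv hsum j
    have h48 := h.abs_correlation_eq hu hv j
    have : correlation u v j = 6 ∨ correlation u v j = -6 := by
      rcases abs_cases (correlation u v j) with ha | ha <;> rw [ha.1] at h48 <;> omega
    rcases this with h | h <;> rw [h] <;> norm_num
  have hsq {u v : Fin 24 → ℤ} (h : ∀ j, correlation u v j ^ 2 = 36) :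
      ∑ i, (u i + v i) ^ 2 = 36 := by
    have h' := sum_correlation_sq (u + v)
    have hs : ∑ j, correlation u v j ^ 2 = 24 * 36 := by simp [h]
    simp only [correlation] at hs
    rw [hs, dotProduct] at h'
    simp only [Pi.add_apply, ← sq] at h'
    linarith
  have hbij : Function.Bijective paleyReflect :=
    Finite.injective_iff_bijective.1 (by decide +kernel)
  have hsign : ∀ i, paleyReflectSign i = 1 ∨ paleyReflectSign i = -1 := by decide +kernel
  have hreflect {u : Fin 24 → ℤ} (hu : ∀ i, u i = 1 ∨ u i = -1) (i : Fin 24) :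
      signedPerm paleyReflect paleyReflectSign u i = 1 ∨
        signedPerm paleyReflect paleyReflectSign u i = -1 := by
    rw [signedPerm]
    rcases hsign i with h | h <;> rcases hu (paleyReflect i) with h' | h' <;> simp [h, h']
  have hreflect_sum (u : Fin 24 → ℤ) :
      ∑ i, signedPerm paleyReflect paleyReflectSign u i = ∑ i, u i - 2 * u 0 := by
    have hs : ∀ i, paleyReflectSign i = 1 - 2 * if paleyReflect i = 0 then 1 else 0 := by
      decide +kernel
    simp only [signedPerm, hs]
    rw [hbij.sum_comp fun k => (1 - 2 * if k = 0 then 1 else 0) * u k]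
    simp [sub_mul, Finset.sum_sub_distrib]
  have hodd {v : Fin 24 → ℤ} (hv : ∀ i, v i = 1 ∨ v i = -1) : (2 : ℤ) ∣ ∑ i, v i := by
    have : ∑ i, v i = ∑ i, (v i - 1) + 24 := by simp
    rw [this]
    refine dvd_add (Finset.dvd_sum fun i _ => ?_) (by norm_num)
    rcases hv i with h | h <;> simp [h]
  have h1 := hsq (haux h hu hv hsum)
  have h2 := hsq (haux h.reflect (hreflect hu) (neg_eq_one_or_neg_one (hreflect hv)) (by
    simp only [Pi.neg_apply, Finset.sum_neg_distrib, hreflect_sum]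
    have := hodd hv
    have := hu 0
    have := hv 0
    omega))
  have h3 : ∑ i, (signedPerm paleyReflect paleyReflectSign u i +
      (-signedPerm paleyReflect paleyReflectSign v) i) ^ 2 = ∑ i, (u i - v i) ^ 2 := by
    rw [← hbij.sum_comp fun i => (u i - v i) ^ 2]
    refine Finset.sum_congr rfl fun i _ => ?_
    rw [Pi.neg_apply, signedPerm, signedPerm]
    rcases hsign i with h | h <;> rw [h] <;> ring
  have h4 : ∑ i, ((u i + v i) ^ 2 + (u i - v i) ^ 2) = ∑ i : Fin 24, (4 : ℤ) := by
    refine Finset.sum_congr rfl fun i _ => ?_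
    rcases hu i with h | h <;> rcases hv i with h' | h' <;> rw [h, h'] <;> norm_num
  rw [Finset.sum_add_distrib, h1, ← h3, h2] at h4
  simp at h4

/-! ### The lattice -/

/-- The first half of a vector of length `48`. -/
def leftHalf (x : Fin 48 → ℤ) (i : Fin 24) : ℤ := x (Fin.castAdd 24 i)

/-- The second half of a vector of length `48`. -/
def rightHalf (x : Fin 48 → ℤ) (i : Fin 24) : ℤ := x (Fin.natAdd 24 i)

theorem sum_halves {M : Type*} [AddCommMonoid M] (f : Fin 48 → M) :
    ∑ i, f i = ∑ i : Fin 24, f (Fin.castAdd 24 i) + ∑ i : Fin 24, f (Fin.natAdd 24 i) :=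
  Fin.sum_univ_add (a := 24) (b := 24) f

theorem dotProduct_halves (x y : Fin 48 → ℤ) :
    x ⬝ᵥ y = leftHalf x ⬝ᵥ leftHalf y + rightHalf x ⬝ᵥ rightHalf y :=
  sum_halves _

theorem ternaryWeight_le (u : Fin 24 → ℤ) : (ternaryWeight u : ℤ) ≤ u ⬝ᵥ u := by
  rw [ternaryWeight, Nat.cast_sum, dotProduct]
  refine Finset.sum_le_sum fun i _ => ?_
  split_ifs with h
  · exact mul_self_nonneg _
  · have : u i ≠ 0 := fun h0 => h (h0 ▸ dvd_zero 3)
    have := mul_self_pos.2 this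
    push_cast
    omega

theorem nine_dvd_dotProduct_self {u : Fin 24 → ℤ} (hu : ∀ i, (3 : ℤ) ∣ u i) :
    (9 : ℤ) ∣ u ⬝ᵥ u :=
  Finset.dvd_sum fun i _ => mul_dvd_mul (hu i) (hu i)

/-- Integral vectors, congruent to a codeword modulo `3`, that form the unimodular lattice of the
Pless symmetry code, rescaled by `√12`. -/
structure IsPlessVector (x : Fin 48 → ℤ) : Prop where
  parity : ∀ i, (2 : ℤ) ∣ x i - x 0
  sum : (4 : ℤ) ∣ ∑ i, x i - 2 * x 0
  code : IsCodeword (leftHalf x) (rightHalf x)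

namespace IsPlessVector

variable {x y : Fin 48 → ℤ}

theorem add (hx : IsPlessVector x) (hy : IsPlessVector y) : IsPlessVector (x + y) where
  parity i := by
    have := hx.parity i
    have := hy.parity i
    simp only [Pi.add_apply]
    omega
  sum := by
    have := hx.sum
    have := hy.sum
    simp only [Pi.add_apply, Finset.sum_add_distrib]
    omega
  code := hx.code.add hy.code

theorem smul (c : ℤ) (hx : IsPlessVector x) : IsPlessVector (c • x) where
  parity i := by
    simp only [Pi.smul_apply, ← smul_sub]
    exact (hx.parity i).mul_left c
  sum := by
    have : ∑ i, (c • x) i - 2 * (c • x) 0 = c * (∑ i, x i - 2 * x 0) := by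
      simp only [Pi.smul_apply, smul_eq_mul, ← Finset.mul_sum]
      ring
    rw [this]
    exact hx.sum.mul_left c
  code := hx.code.smul c

theorem exists_eq_add (hx : IsPlessVector x) :
    ∃ (a : Fin 48 → ℤ) (k : ℤ), (∀ i, x i = x 0 + 2 * a i) ∧ ∑ i, a i = x 0 + 2 * k := by
  choose a ha using hx.parity
  obtain ⟨k, hk⟩ := hx.sum
  have hsum : ∑ i, (x i - x 0) = 2 * ∑ i, a i := by
    rw [Finset.mul_sum]
    exact Finset.sum_congr rfl fun i _ => ha i
  rw [Finset.sum_sub_distrib] at hsum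
  simp only [Finset.sum_const, Finset.card_univ, Fintype.card_fin, nsmul_eq_mul] at hsum
  push_cast at hsum
  exact ⟨a, k - 12 * x 0, fun i => by linarith [ha i], by linarith⟩

theorem twelve_dvd_dotProduct (hx : IsPlessVector x) (hy : IsPlessVector y) :
    (12 : ℤ) ∣ x ⬝ᵥ y := by
  have h3 : (3 : ℤ) ∣ x ⬝ᵥ y := by
    rw [dotProduct_halves]
    exact hx.code.dvd_dotProduct hy.code
  have h4 : (4 : ℤ) ∣ x ⬝ᵥ y := by
    obtain ⟨a, k, ha, hk⟩ := hx.exists_eq_add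
    obtain ⟨b, l, hb, hl⟩ := hy.exists_eq_add
    have : x ⬝ᵥ y = 48 * (x 0 * y 0) + 2 * x 0 * ∑ i, b i + 2 * y 0 * ∑ i, a i +
        4 * ∑ i, a i * b i := by
      rw [dotProduct, Finset.mul_sum, Finset.mul_sum, Finset.mul_sum,
        show 48 * (x 0 * y 0) = ∑ _i : Fin 48, x 0 * y 0 by simp,
        ← Finset.sum_add_distrib, ← Finset.sum_add_distrib, ← Finset.sum_add_distrib]
      refine Finset.sum_congr rfl fun i _ => ?_
      rw [ha i, hb i]
      ring
    rw [this, hk, hl]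
    exact ⟨13 * (x 0 * y 0) + x 0 * l + y 0 * k + ∑ i, a i * b i, by ring⟩
  omega

theorem twentyFour_dvd_dotProduct_self (hx : IsPlessVector x) : (24 : ℤ) ∣ x ⬝ᵥ x := by
  have h12 := hx.twelve_dvd_dotProduct hx
  have h8 : (8 : ℤ) ∣ x ⬝ᵥ x := by
    obtain ⟨a, k, ha, hk⟩ := hx.exists_eq_add
    obtain ⟨m, hm⟩ : (2 : ℤ) ∣ ∑ i, (a i * a i - a i) :=
      Finset.dvd_sum fun i _ => by
        have := Int.even_mul_pred_self (a i)
        rw [mul_sub, mul_one] at this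
        exact this.two_dvd
    rw [Finset.sum_sub_distrib] at hm
    have : x ⬝ᵥ x = 48 * (x 0 * x 0) + 4 * x 0 * ∑ i, a i + 4 * ∑ i, a i * a i := by
      rw [dotProduct, Finset.mul_sum, Finset.mul_sum,
        show 48 * (x 0 * x 0) = ∑ _i : Fin 48, x 0 * x 0 by simp,
        ← Finset.sum_add_distrib, ← Finset.sum_add_distrib]
      refine Finset.sum_congr rfl fun i _ => ?_
      rw [ha i]
      ring
    obtain ⟨n, hn⟩ : (2 : ℤ) ∣ x 0 * x 0 + x 0 := by
      have := Int.even_mul_succ_self (x 0)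
      rw [mul_add, mul_one] at this
      exact this.two_dvd
    refine ⟨6 * (x 0 * x 0) + x 0 * k + n + k + m, ?_⟩
    rw [this]
    linear_combination (4 * x 0 + 4) * hk + 4 * hm + 4 * hn
  omega

theorem le_dotProduct_self_of_even (hx : IsPlessVector x) (h0 : (2 : ℤ) ∣ x 0)
    (hpos : 0 < x ⬝ᵥ x) : 72 ≤ x ⬝ᵥ x := by
  by_contra! hlt
  have h2 (i : Fin 48) : (2 : ℤ) ∣ x i := by
    have := hx.parity i
    omega
  choose y hy using h2
  obtain rfl : x = (2 : ℤ) • y := funext hy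
  have h24 := hx.twentyFour_dvd_dotProduct_self
  have hcode : IsCodeword (leftHalf y) (rightHalf y) :=
    IsCodeword.of_smul (c := 2) (by norm_num) hx.code
  rw [smul_dotProduct, dotProduct_smul, smul_eq_mul, smul_eq_mul] at h24 hlt hpos
  rw [dotProduct_halves] at h24 hlt hpos
  by_cases hl : ∀ i, (3 : ℤ) ∣ leftHalf y i
  · have h9 := nine_dvd_dotProduct_self hl
    have h9' := nine_dvd_dotProduct_self (hcode.dvd_of_dvd_left hl)
    omega
  · have := hcode.lt_ternaryWeight hl
    have := ternaryWeight_le (leftHalf y)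
    have := ternaryWeight_le (rightHalf y)
    omega

theorem le_dotProduct_self_of_odd (hx : IsPlessVector x) (h0 : ¬ (2 : ℤ) ∣ x 0) :
    72 ≤ x ⬝ᵥ x := by
  by_contra! hlt
  have h24 := hx.twentyFour_dvd_dotProduct_self
  have hle (i : Fin 48) : 0 ≤ x i * x i - 1 := by
    have : x i ≠ 0 := fun h => by
      have := hx.parity i
      omega
    have := mul_self_pos.2 this
    omega
  have hsum : ∑ i, (x i * x i - 1) = x ⬝ᵥ x - 48 := by
    rw [Finset.sum_sub_distrib, dotProduct]
    simp
  have hzero : ∑ i, (x i * x i - 1) = 0 :=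
    le_antisymm (by omega) (Finset.sum_nonneg fun i _ => hle i)
  have hone (i : Fin 48) : x i = 1 ∨ x i = -1 := by
    have := (Finset.sum_eq_zero_iff_of_nonneg fun i _ => hle i).1 hzero i (Finset.mem_univ i)
    exact mul_self_eq_one_iff.1 (by omega)
  refine hx.code.sum_emod_ne (fun i => hone _) (fun i => hone _) ?_
  have hs := hx.sum
  rw [sum_halves] at hs
  simp only [leftHalf, rightHalf]
  omega

theorem le_dotProduct_self (hx : IsPlessVector x) (hpos : 0 < x ⬝ᵥ x) : 72 ≤ x ⬝ᵥ x := by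
  by_cases h0 : (2 : ℤ) ∣ x 0
  · exact hx.le_dotProduct_self_of_even h0 hpos
  · exact hx.le_dotProduct_self_of_odd h0

end IsPlessVector

theorem isCodeword_of_dvd {u v : Fin 24 → ℤ} (hu : ∀ i, (3 : ℤ) ∣ u i) (hv : ∀ i, (3 : ℤ) ∣ v i) :
    IsCodeword u v := by
  intro j
  rw [Matrix.vecMul, dotProduct]
  exact dvd_sub (hv j) (Finset.dvd_sum fun i _ => (hu i).mul_right _)

theorem isPlessVector_of_four_dvd {x : Fin 48 → ℤ} (hx : ∀ i, (4 : ℤ) ∣ x i)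
    (hcode : IsCodeword (leftHalf x) (rightHalf x)) : IsPlessVector x where
  parity i := by
    have := hx i
    have := hx 0
    omega
  sum := dvd_sub (Finset.dvd_sum fun i _ => hx i) ((hx 0).mul_left 2)
  code := hcode

theorem isPlessVector_single (i : Fin 48) : IsPlessVector (Pi.single i 12) := by
  have h (k : ℤ) (hk : k ∣ 12) (j : Fin 48) : k ∣ (Pi.single i 12 : Fin 48 → ℤ) j := by
    rw [Pi.single_apply]
    split_ifs
    · exact hk
    · exact dvd_zero _
  exact isPlessVector_of_four_dvd (h 4 (by norm_num))
    (isCodeword_of_dvd (fun _ => h 3 (by norm_num) _) fun _ => h 3 (by norm_num) _)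

theorem isPlessVector_single_add_single (i : Fin 48) :
    IsPlessVector (Pi.single i 6 + Pi.single 0 6) := by
  have h (j : Fin 48) : (6 : ℤ) ∣ (Pi.single i 6 + Pi.single 0 6 : Fin 48 → ℤ) j := by
    rw [Pi.add_apply, Pi.single_apply, Pi.single_apply]
    refine dvd_add ?_ ?_ <;> split_ifs <;> norm_num
  refine ⟨fun j => ?_, ?_, isCodeword_of_dvd (fun _ => ?_) fun _ => ?_⟩
  · have := h j
    have := h 0
    omega
  · have : ∑ j, (Pi.single i 6 + Pi.single 0 6 : Fin 48 → ℤ) j = 12 := by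
      simp [Finset.sum_add_distrib]
    rw [this]
    have := h 0
    omega
  · exact (by norm_num : (3 : ℤ) ∣ 6).trans (h _)
  · exact (by norm_num : (3 : ℤ) ∣ 6).trans (h _)

theorem isPlessVector_three_sub_single : IsPlessVector (3 - Pi.single 0 6) := by
  have h (j : Fin 48) : (3 - Pi.single 0 6 : Fin 48 → ℤ) j = 3 - if j = 0 then 6 else 0 := by
    rw [Pi.sub_apply, Pi.single_apply]
    rfl
  have h3 (j : Fin 48) : (3 : ℤ) ∣ (3 - Pi.single 0 6 : Fin 48 → ℤ) j := by
    rw [h]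
    split_ifs <;> norm_num
  refine ⟨fun j => ?_, ?_, isCodeword_of_dvd (fun _ => h3 _) fun _ => h3 _⟩
  · rw [h, h]
    split_ifs <;> norm_num
  · simp only [h, Finset.sum_sub_distrib]
    simp

/-- The generator of the lattice coming from the row `q` of the generator matrix `(1, S)`. -/
def generator (q : Fin 24) : Fin 48 → ℤ :=
  Fin.append (m := 24) (n := 24) (Pi.single q 4) ((4 : ℤ) • paley q)

theorem leftHalf_generator (q : Fin 24) : leftHalf (generator q) = Pi.single q 4 :=
  funext fun _ => Fin.append_left ..

theorem rightHalf_generator (q : Fin 24) : rightHalf (generator q) = (4 : ℤ) • paley q :=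
  funext fun _ => Fin.append_right ..

theorem isPlessVector_generator (q : Fin 24) : IsPlessVector (generator q) := by
  refine isPlessVector_of_four_dvd (fun i => ?_) ?_
  · refine Fin.addCases (m := 24) (n := 24) (motive := fun i => (4 : ℤ) ∣ generator q i)
      (fun i => ?_) (fun i => ?_) i
    · change (4 : ℤ) ∣ leftHalf (generator q) i
      rw [leftHalf_generator, Pi.single_apply]
      split_ifs <;> simp
    · change (4 : ℤ) ∣ rightHalf (generator q) i
      rw [rightHalf_generator]
      exact dvd_mul_right _ _
  · intro j
    rw [leftHalf_generator, rightHalf_generator, Matrix.single_vecMul]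
    simp [paleyMatrix, Matrix.row]

theorem isPlessVector_of_forall_dvd {t : Fin 48 → ℤ}
    (h : ∀ x, IsPlessVector x → (12 : ℤ) ∣ t ⬝ᵥ x) : IsPlessVector t where
  parity i := by
    have := h _ (isPlessVector_single_add_single i)
    rw [dotProduct_add, dotProduct_single, dotProduct_single] at this
    omega
  sum := by
    have := h _ isPlessVector_three_sub_single
    have h3 : t ⬝ᵥ 3 = 3 * ∑ i, t i := by
      simp [dotProduct, Finset.mul_sum, mul_comm]
    rw [dotProduct_sub, dotProduct_single, h3] at this
    omega
  code := by
    refine IsCodeword.swap fun q => ?_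
    have := h _ (isPlessVector_generator q)
    rw [dotProduct_halves, leftHalf_generator, rightHalf_generator, dotProduct_single,
      dotProduct_smul, smul_eq_mul] at this
    have h' : rightHalf t ⬝ᵥ paley q = -(rightHalf t ᵥ* paleyMatrix) q := by
      have hT : paley q = fun j => -paley j q := by
        ext j
        exact congrFun (congrFun paleyMatrix_transpose j) q
      rw [hT]
      simp [Matrix.vecMul, dotProduct, paleyMatrix]
    rw [h'] at this
    omega

/-! ### The rescaled lattice -/

/-- The vector `x / √12`. -/
noncomputable def rescale (x : Fin 48 → ℤ) (i : Fin 48) : ℝ := x i / √12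

theorem ip_rescale (y : Fin 48 → ℝ) (x : Fin 48 → ℤ) :
    ip y (rescale x) = (∑ i, y i * x i) / √12 := by
  rw [ip, Finset.sum_div]
  exact Finset.sum_congr rfl fun i _ => (mul_div_assoc ..).symm

theorem ip_rescale_rescale (x y : Fin 48 → ℤ) :
    ip (rescale x) (rescale y) = ((x ⬝ᵥ y : ℤ) : ℝ) / 12 := by
  have h12 : √12 * √12 = (12 : ℝ) := Real.mul_self_sqrt (by norm_num)
  rw [ip, dotProduct, Int.cast_sum, Finset.sum_div]
  refine Finset.sum_congr rfl fun i _ => ?_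
  rw [rescale, rescale, div_mul_div_comm, h12, Int.cast_mul]

/-- The extremal even unimodular lattice of the Pless symmetry code of length `48`. -/
noncomputable def plessLattice : Submodule ℤ (Fin 48 → ℝ) where
  carrier := {y | ∃ x, IsPlessVector x ∧ y = rescale x}
  add_mem' := by
    rintro _ _ ⟨x, hx, rfl⟩ ⟨y, hy, rfl⟩
    refine ⟨x + y, hx.add hy, ?_⟩
    ext i
    simp [rescale, add_div]
  zero_mem' := ⟨0, ⟨by simp, by simp, isCodeword_of_dvd (fun _ => dvd_zero 3) fun _ => dvd_zero 3⟩,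
    by ext i; simp [rescale]⟩
  smul_mem' := by
    rintro c _ ⟨x, hx, rfl⟩
    refine ⟨c • x, hx.smul c, ?_⟩
    ext i
    simp [rescale, mul_div_assoc]

theorem rescale_mem {x : Fin 48 → ℤ} (hx : IsPlessVector x) : rescale x ∈ plessLattice :=
  ⟨x, hx, rfl⟩

theorem rescale_single (i : Fin 48) (c : ℤ) :
    rescale (Pi.single i c) = (c / √12 : ℝ) • Pi.single i (1 : ℝ) := by
  ext j
  rw [rescale, Pi.smul_apply, Pi.single_apply, Pi.single_apply]
  split_ifs <;> simp

theorem isLatticeIn_plessLattice : IsLatticeIn plessLattice := by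
  have h12 : (√12 : ℝ) ≠ 0 := by positivity
  constructor
  · let b : Module.Basis (Fin 48) ℝ (Fin 48 → ℝ) :=
      (Pi.basisFun ℝ (Fin 48)).isUnitSMul (w := fun _ => (√12)⁻¹)
        fun _ => (inv_ne_zero h12).isUnit
    refine DiscreteTopology.of_subset (s := (Submodule.span ℤ (Set.range b) : Set (Fin 48 → ℝ)))
      (inferInstanceAs (DiscreteTopology (Submodule.span ℤ (Set.range b)))) ?_
    rintro _ ⟨x, -, rfl⟩
    have : rescale x = ∑ i, x i • b i := by
      ext j
      simp [rescale, b, Module.Basis.isUnitSMul_apply, Pi.single_apply, div_eq_mul_inv, mul_comm]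
    rw [this]
    exact Submodule.sum_mem _ fun i _ =>
      Submodule.smul_mem _ _ (Submodule.subset_span (Set.mem_range_self i))
  · rw [eq_top_iff, ← (Pi.basisFun ℝ (Fin 48)).span_eq, Submodule.span_le]
    rintro _ ⟨i, rfl⟩
    have hmem := Submodule.subset_span (R := ℝ) (rescale_mem (isPlessVector_single i))
    rw [rescale_single] at hmem
    have := Submodule.smul_mem _ (√12 / 12) hmem
    rw [smul_smul] at this
    have h1 : √12 / 12 * (((12 : ℤ) : ℝ) / √12) = 1 := by
      push_cast
      field_simp
    rwa [h1, one_smul, ← Pi.basisFun_apply] at this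

theorem isUnimodularLattice_plessLattice : IsUnimodularLattice plessLattice := by
  have h12 : √12 * √12 = (12 : ℝ) := Real.mul_self_sqrt (by norm_num)
  have h0 : (√12 : ℝ) ≠ 0 := by positivity
  ext y
  constructor
  · rintro ⟨x, hx, rfl⟩ _ ⟨x', hx', rfl⟩
    obtain ⟨z, hz⟩ := hx.twelve_dvd_dotProduct hx'
    refine ⟨z, ?_⟩
    rw [ip_rescale_rescale, hz]
    push_cast
    field_simp
  · intro hy
    have hint (i : Fin 48) : ∃ t : ℤ, y i * √12 = t := by
      obtain ⟨z, hz⟩ := hy _ (rescale_mem (isPlessVector_single i))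
      refine ⟨z, ?_⟩
      rw [← hz, ip_rescale]
      simp [Pi.single_apply]
      field_simp
      rw [sq, h12]
    choose t ht using hint
    have hyt : y = rescale t := by
      ext i
      rw [rescale, ← ht, mul_div_cancel_right₀ _ h0]
    refine ⟨t, isPlessVector_of_forall_dvd fun x hx => ?_, hyt⟩
    obtain ⟨z, hz⟩ := hy _ (rescale_mem hx)
    rw [hyt, ip_rescale_rescale, div_eq_iff (by norm_num)] at hz
    refine ⟨z, ?_⟩
    rw [mul_comm]
    exact_mod_cast hz

theorem isEvenLattice_plessLattice : IsEvenLattice plessLattice := by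
  rintro _ ⟨x, hx, rfl⟩
  obtain ⟨z, hz⟩ := hx.twentyFour_dvd_dotProduct_self
  refine ⟨z, ?_⟩
  rw [ip_rescale_rescale, hz]
  push_cast
  ring

theorem hasMinNorm_plessLattice : HasMinNorm plessLattice 6 := by
  constructor
  · have hip : ip (rescale (Pi.single 1 6 + Pi.single 0 6))
        (rescale (Pi.single 1 6 + Pi.single 0 6)) = 6 := by
      rw [ip_rescale_rescale, dotProduct_add, dotProduct_single, dotProduct_single]
      norm_num [Pi.single_apply]
    refine ⟨_, rescale_mem (isPlessVector_single_add_single 1), fun h => ?_, hip⟩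
    rw [h] at hip
    simp [ip] at hip
  · rintro _ ⟨_, ⟨x, hx, rfl⟩, hne, rfl⟩
    have hpos : 0 < x ⬝ᵥ x := by
      refine lt_of_le_of_ne (Finset.sum_nonneg fun i _ => mul_self_nonneg _) fun h => hne ?_
      rw [eq_comm, dotProduct_self_eq_zero] at h
      ext i
      simp [rescale, h]
    have := hx.le_dotProduct_self hpos
    rw [ip_rescale_rescale, le_div_iff₀ (by norm_num)]
    norm_num
    exact_mod_cast this

/-! ### The frame -/

/-- The frame vectors with entries in `{-1, 0, 1}`, increased by one and read in base `3`. -/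
def frameCodes : List ℕ :=
  [63171463302715663501870, 29031507285799649321014, 22303903104629029915074,
    15766712327800408492252, 58796368293656175368634, 56601789371326074874338,
    51860621065718950262716, 72383926407301731907200, 13594220102049362987204,
    74080516381771555126796, 31615387708175033125610, 73397945653083148081682,
    17798102050698392355060, 50048393231325661860214, 27148244732009028484798,
    43051500077094558502080, 9723983491923484123834, 65075321547081296904094,
    28806692595246110113866, 46667003332219922175746, 69756903640141536718120,
    41424260015685209622912, 22995506433123460492122, 10145374322272671845676,
    15842090210161422757978, 43958274350850048813178, 31056079131367594439234,
    15991961529440297862418, 67230819931927337301510, 31688716485506286895260,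
    25842117120472572422738, 17555596406591582016562, 6384612069746449355140,
    60953737470742351982668, 27572007497902725484856, 47874668715609490835172,
    29699795005697748589418, 5089692895128223907812, 64019188129831675837190,
    61564658983994343049518, 78593138361873202175764, 76845228102271730314892,
    49848917242546405628162, 45860620855253871660708, 69239015528453488956156,
    40914199198371416237002, 75263268134846212519350, 69257899745489952274418]

/-- The vectors of the frame, before rescaling by `2 / √12`. -/
def frameVector (i j : Fin 48) : ℤ := Int.subNatNat (frameCodes.getD i 0 / 3 ^ j.val % 3) 1

theorem frameVector_dotProduct (i j : Fin 48) :
    frameVector i ⬝ᵥ frameVector j = if i = j then 30 else 0 := by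
  have h : ∀ i j : Fin 48, ∑ k, frameVector i k * frameVector j k = if i = j then 30 else 0 := by
    decide +kernel
  exact h i j

theorem isPlessVector_two_smul_frameVector (i : Fin 48) :
    IsPlessVector ((2 : ℤ) • frameVector i) := by
  have hcode : ∀ (i : Fin 48) (j : Fin 24), (3 : ℤ) ∣ rightHalf (frameVector i) j -
      ∑ k, leftHalf (frameVector i) k * paley k j := by decide +kernel
  have hsum : ∀ i : Fin 48, (2 : ℤ) ∣ ∑ j, frameVector i j := by decide +kernel
  refine ⟨fun j => ?_, ?_, IsCodeword.smul 2 (hcode i)⟩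
  · exact dvd_sub (dvd_mul_right _ _) (dvd_mul_right _ _)
  · simp only [Pi.smul_apply, smul_eq_mul, ← Finset.mul_sum]
    have := hsum i
    omega

/-- a 48-dimensional extremal even unimodular lattice with a 10-frame. -/
theorem exists_extremal_even_unimodular_48_with_10_frame :
    ∃ L : Submodule ℤ (Fin 48 → ℝ), IsLatticeIn L ∧ IsUnimodularLattice L ∧
      IsEvenLattice L ∧ HasMinNorm L 6 ∧
      ∃ f : Fin 48 → (Fin 48 → ℝ), (∀ i, f i ∈ L) ∧
        ∀ i j, ip (f i) (f j) = if i = j then 10 else 0 := by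
  refine ⟨plessLattice, isLatticeIn_plessLattice, isUnimodularLattice_plessLattice,
    isEvenLattice_plessLattice, hasMinNorm_plessLattice,
    fun i => rescale ((2 : ℤ) • frameVector i),
    fun i => rescale_mem (isPlessVector_two_smul_frameVector i), fun i j => ?_⟩
  rw [ip_rescale_rescale, smul_dotProduct, dotProduct_smul, frameVector_dotProduct]
  split_ifs <;> norm_num
end
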